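/- Let μ = (m, n−m) ⊢ n, and let R, S, T be multisets of positive integers with |R|+|S|+|T| = n, |R| ≤ m and |S| > m; let 𝒮 be the set of pairs (U,V) with S = U ⊔ V and |U| = m − |R|, and A[U,V] the row-standard μ-tableau with rows R ⊔ U and T ⊔ V. Set r = |R|, s = |S|, t = |T|, u = m − r, v = n − m − t. Let E be the row-standard (r,s,t)-tableau with (E^1, E^2, E^3) = (R, S, T), let B be the row-standard (r+u, v+t)-tableau with r ones and u twos in its first row and v threes and t fours in its second row, and let D be the (r,u,v,t)-tableau with all row-1 entries equal to 1, all row-2 and row-3 entries equal to 2, and all row-4 entries equal to 3. Then φ_B φ_D φ_E = ∑_{(U,V)∈𝒮} (∏_i [R_i+U_i choose R_i]_q [T_i+V_i choose T_i]_q) (∏_{i<j} q^{R_j U_i + T_i V_j}) φ_{A[U,V]} as homomorphisms M^μ → M^λ, where λ is the common type of the A[U,V] and composites apply the left factor first. -/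

import Mathlib

open scoped Classical

noncomputable section

namespace FayersSemistd

/-- The value at `q` of the Gaussian (quantum) binomial coefficient polynomial
`[a choose b]`, defined via the `q`-Pascal recurrence. -/
def qBinom {F : Type*} [Field F] (q : F) : ℕ → ℕ → F
  | _, 0 => 1
  | 0, _+1 => 0
  | a+1, b+1 => qBinom q a b + q ^ (b+1) * qBinom q a (b+1)

/-- `∏_i [A_i + B_i choose A_i]_q`, where `A_i`, `B_i` are multiplicities in the
multisets `A` and `B`. -/
def qBinomProd {F : Type*} [Field F] (q : F) (A B : Multiset ℕ) : F :=
  ∏ i ∈ (A + B).toFinset, qBinom q ((A + B).count i) (A.count i)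

/-- `∑_{i<j} A_j * B_i` : the number of pairs `(x,y)` with `x ∈ A`, `y ∈ B`, `y < x`,
counted with multiplicity. -/
def invPairs (A B : Multiset ℕ) : ℕ :=
  ((A.product B).filter (fun p => p.2 < p.1)).card

/-- The Coxeter length of a permutation of `{0,…,n-1}`: its number of inversions. -/
def permLength {n : ℕ} (w : Equiv.Perm (Fin n)) : ℕ :=
  (Finset.univ.filter (fun p : Fin n × Fin n => p.1 < p.2 ∧ w p.2 < w p.1)).card

/-- `λ_0 + ⋯ + λ_{r-1}`. -/
def cumSum (lam : ℕ → ℕ) (r : ℕ) : ℕ := ∑ i ∈ Finset.range r, lam i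

/-- The (0-indexed) row of the diagram of `λ` containing the (0-indexed) position `p`,
when positions are listed row by row. -/
def rowOf (lam : ℕ → ℕ) (p : ℕ) : ℕ := sInf {r | p < cumSum lam (r+1)}

/-- `λ` is a composition of `n`: finitely many nonzero parts, summing to `n`. -/
def IsComposition (n : ℕ) (lam : ℕ → ℕ) : Prop :=
  ∃ N, (∀ r, N ≤ r → lam r = 0) ∧ cumSum lam N = n

/-- `μ` is a partition of `n`. -/
def IsPartition (n : ℕ) (mu : ℕ → ℕ) : Prop := IsComposition n mu ∧ Antitone mu

/-- The conjugate partition (0-indexed): `conjP μ i = #{r | μ r > i}`. -/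
def conjP (mu : ℕ → ℕ) (i : ℕ) : ℕ := sInf {r | mu r ≤ i}

/-- The standard Young subgroup `W_λ` of `S_n` (as a set): the permutations preserving
each consecutive block of sizes `λ_0, λ_1, …`. -/
def youngW {n : ℕ} (lam : ℕ → ℕ) : Set (Equiv.Perm (Fin n)) :=
  {w | ∀ p : Fin n, rowOf lam ((w p : Fin n) : ℕ) = rowOf lam (p : ℕ)}

/-- The adjacent transposition `(i, i+1)` (0-indexed) in `S_n`. -/
def adjT {n : ℕ} (i : ℕ) (h : i + 1 < n) : Equiv.Perm (Fin n) :=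
  Equiv.swap ⟨i, Nat.lt_of_succ_lt h⟩ ⟨i+1, h⟩

/-- `T : S_n → H` is the standard basis of an Iwahori–Hecke algebra of `S_n` over `F`
with parameter `q`.  Permutations act on the right, so the product `w·s` of the paper
is `s * w` in Mathlib's convention; the multiplication rule
`T_w T_s = T_{ws}` (length increasing) resp. `T_w T_s = q T_{ws} + (q-1) T_w`
(length decreasing) determines the algebra structure on the basis. -/
structure IsHeckeBasis {F : Type*} [Field F] {H : Type*} [Ring H] [Algebra F H] {n : ℕ}
    (q : F) (T : Equiv.Perm (Fin n) → H) : Prop where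
  li : LinearIndependent F T
  total : Submodule.span F (Set.range T) = ⊤
  one : T 1 = 1
  mul_adj_asc : ∀ (w : Equiv.Perm (Fin n)) (i : ℕ) (h : i + 1 < n),
    permLength w < permLength (adjT i h * w) →
    T w * T (adjT i h) = T (adjT i h * w)
  mul_adj_desc : ∀ (w : Equiv.Perm (Fin n)) (i : ℕ) (h : i + 1 < n),
    permLength (adjT i h * w) < permLength w →
    T w * T (adjT i h) = q • T (adjT i h * w) + (q - 1) • T w

variable {F : Type*} [Field F] {H : Type*} [Ring H] [Algebra F H] {n : ℕ}

/-- `x_λ = ∑_{w ∈ W_λ} T_w`. -/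
def xElt (T : Equiv.Perm (Fin n) → H) (lam : ℕ → ℕ) : H :=
  ∑ w ∈ Finset.univ.filter (· ∈ youngW lam), T w

/-- `y_λ = ∑_{w ∈ W_λ} (-q)^{-l(w)} T_w`. -/
def yElt (q : F) (T : Equiv.Perm (Fin n) → H) (lam : ℕ → ℕ) : H :=
  ∑ w ∈ Finset.univ.filter (· ∈ youngW lam), ((-q)⁻¹) ^ permLength w • T w

/-- The double coset `W_λ d W_μ` (paper convention: maps act on the right, so the
paper product `u·d·v` is `v * d * u` in Mathlib's convention). -/
def doubleCoset {n : ℕ} (lam mu : ℕ → ℕ) (d : Equiv.Perm (Fin n)) :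
    Set (Equiv.Perm (Fin n)) :=
  {w | ∃ u ∈ youngW (n := n) lam, ∃ v ∈ youngW (n := n) mu, w = v * d * u}

/-- `∑_{w ∈ W_λ 1_A W_μ} T_w`, the image `x_μ φ_A` of `x_μ` under the tableau
homomorphism `φ_A : M^μ → M^λ`, where `d = 1_A`. -/
def XPhi (T : Equiv.Perm (Fin n) → H) (lam mu : ℕ → ℕ) (d : Equiv.Perm (Fin n)) : H :=
  ∑ w ∈ Finset.univ.filter (· ∈ doubleCoset lam mu d), T w

/-- A row-standard tableau is recorded by the multisets of entries of its rows; it has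
shape `μ` when row `r` has `μ_r` entries. -/
def RowsOfShape (mu : ℕ → ℕ) (A : ℕ → Multiset ℕ) : Prop := ∀ r, (A r).card = mu r

/-- The tableau with rows `A 0, A 1, …` has type `λ` when the entry `v` occurs `λ_v`
times in total (entries and types are 0-indexed). -/
def HasType (A : ℕ → Multiset ℕ) (lam : ℕ → ℕ) : Prop :=
  ∀ v, (∑ᶠ r, (A r).count v) = lam v

/-- The entry in row `r`, column `c` (0-indexed) of the row-standard tableau with row
multisets `A`. -/
def entryAt (A : ℕ → Multiset ℕ) (r c : ℕ) : ℕ := ((A r).sort (· ≤ ·)).getD c 0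

/-- `d = 1_A` for the row-standard `μ`-tableau `A` of type `λ`: the tableau `t^λ d`
(whose entry at position `p` is `d p`) is row-standard (first clause), and the entry
`d p` lies in row `r` of `t^λ d` exactly when the position occupied by `d p` in `t^μ`
is occupied by `r` in `A` (second clause). -/
def Is1A {n : ℕ} (mu lam : ℕ → ℕ) (A : ℕ → Multiset ℕ) (d : Equiv.Perm (Fin n)) : Prop :=
  (∀ p p' : Fin n, rowOf lam (p : ℕ) = rowOf lam (p' : ℕ) → p < p' → d p < d p') ∧
  (∀ p : Fin n,
    entryAt A (rowOf mu ((d p : Fin n) : ℕ))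
      (((d p : Fin n) : ℕ) - cumSum mu (rowOf mu ((d p : Fin n) : ℕ)))
      = rowOf lam (p : ℕ))

/-- A row-standard tableau is semistandard if its columns are strictly increasing. -/
def Semistandard (mu : ℕ → ℕ) (A : ℕ → Multiset ℕ) : Prop :=
  ∀ r c, c < mu (r+1) → entryAt A r c < entryAt A (r+1) c

/-- The (0-indexed) column of the position `p` in the diagram of `μ`. -/
def colIdx (mu : ℕ → ℕ) (p : ℕ) : ℕ := p - cumSum mu (rowOf mu p)

/-- `w = w_μ`, i.e. `t^μ w = t_μ`: the image of position `p` is the number of positions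
coming strictly before `p` in the column-reading order of the diagram of `μ`. -/
def IsWmu {n : ℕ} (mu : ℕ → ℕ) (w : Equiv.Perm (Fin n)) : Prop :=
  ∀ p : Fin n, ((w p : Fin n) : ℕ) = (Finset.univ.filter (fun p' : Fin n =>
    colIdx mu (p' : ℕ) < colIdx mu (p : ℕ) ∨
      (colIdx mu (p' : ℕ) = colIdx mu (p : ℕ) ∧ rowOf mu (p' : ℕ) < rowOf mu (p : ℕ)))).card

def comp1 (a : ℕ) : ℕ → ℕ := fun r => if r = 0 then a else 0
def comp2 (a b : ℕ) : ℕ → ℕ := fun r => if r = 0 then a else if r = 1 then b else 0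
def comp3 (a b c : ℕ) : ℕ → ℕ :=
  fun r => if r = 0 then a else if r = 1 then b else if r = 2 then c else 0
def comp4 (a b c d : ℕ) : ℕ → ℕ :=
  fun r => if r = 0 then a else if r = 1 then b else if r = 2 then c else if r = 3 then d else 0
def rows1 (a : Multiset ℕ) : ℕ → Multiset ℕ := fun r => if r = 0 then a else 0
def rows2 (a b : Multiset ℕ) : ℕ → Multiset ℕ :=
  fun r => if r = 0 then a else if r = 1 then b else 0
def rows3 (a b c : Multiset ℕ) : ℕ → Multiset ℕ :=
  fun r => if r = 0 then a else if r = 1 then b else if r = 2 then c else 0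
def rows4 (a b c d : Multiset ℕ) : ℕ → Multiset ℕ :=
  fun r => if r = 0 then a else if r = 1 then b else if r = 2 then c else if r = 3 then d else 0

end FayersSemistd
namespace FayersSemistd

/-! ### Permutations and inversions -/

/-- The number of inversions `(a, b)` of `w` such that `w a` and `w b` lie in the same fibre
of `ρ`. -/
def blockInv {n : ℕ} (ρ : Fin n → ℕ) (w : Equiv.Perm (Fin n)) : ℕ :=
  (Finset.univ.filter (fun p : Fin n × Fin n =>
    p.1 < p.2 ∧ w p.2 < w p.1 ∧ ρ (w p.1) = ρ (w p.2))).card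

/-- The permutations preserving all fibres of `ρ`. -/
def fiberPerms {n : ℕ} (ρ : Fin n → ℕ) : Finset (Equiv.Perm (Fin n)) :=
  Finset.univ.filter (fun w => ∀ p, ρ (w p) = ρ p)

/-- `w⁻¹` is increasing on every fibre of `ρ`. -/
def FiberMin {n : ℕ} (ρ : Fin n → ℕ) (w : Equiv.Perm (Fin n)) : Prop :=
  ∀ a b, a < b → ρ (w a) = ρ (w b) → w a < w b

theorem permLength_eq_blockInv {n : ℕ} (w : Equiv.Perm (Fin n)) :
    permLength w = blockInv (fun _ => 0) w := by
  simp [permLength, blockInv]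

theorem mem_fiberPerms {n : ℕ} {ρ : Fin n → ℕ} {w : Equiv.Perm (Fin n)} :
    w ∈ fiberPerms ρ ↔ ∀ p, ρ (w p) = ρ p := by
  simp [fiberPerms]

theorem mul_mem_fiberPerms {n : ℕ} {ρ : Fin n → ℕ} {v w : Equiv.Perm (Fin n)}
    (hv : v ∈ fiberPerms ρ) (hw : w ∈ fiberPerms ρ) : v * w ∈ fiberPerms ρ := by
  rw [mem_fiberPerms] at *
  intro p
  rw [Equiv.Perm.mul_apply, hv, hw]

theorem inv_mem_fiberPerms {n : ℕ} {ρ : Fin n → ℕ} {v : Equiv.Perm (Fin n)}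
    (hv : v ∈ fiberPerms ρ) : v⁻¹ ∈ fiberPerms ρ := by
  rw [mem_fiberPerms] at *
  intro p
  rw [← hv (v⁻¹ p), Equiv.Perm.coe_inv, Equiv.apply_symm_apply]

theorem adjT_mul_self {n : ℕ} {i : ℕ} (h : i + 1 < n) : adjT i h * adjT i h = 1 :=
  Equiv.swap_mul_self _ _

theorem adjT_mul_cancel {n : ℕ} {i : ℕ} (h : i + 1 < n) (w : Equiv.Perm (Fin n)) :
    adjT i h * (adjT i h * w) = w := by
  rw [← mul_assoc, adjT_mul_self, one_mul]

theorem mul_adjT_cancel {n : ℕ} {i : ℕ} (h : i + 1 < n) (w : Equiv.Perm (Fin n)) :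
    w * adjT i h * adjT i h = w := by
  rw [mul_assoc, adjT_mul_self, mul_one]

theorem adjT_mem_fiberPerms {n : ℕ} {ρ : Fin n → ℕ} {i : ℕ} (h : i + 1 < n)
    (hρ : ρ ⟨i, Nat.lt_of_succ_lt h⟩ = ρ ⟨i + 1, h⟩) : adjT i h ∈ fiberPerms ρ := by
  rw [mem_fiberPerms]
  intro p
  rw [adjT, Equiv.swap_apply_def]
  split_ifs with h1 h2
  · rw [h1, hρ]
  · rw [h2, hρ]
  · rfl

theorem adjT_lt_adjT_iff {n : ℕ} {i : ℕ} (h : i + 1 < n) (x y : Fin n) :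
    adjT i h x < adjT i h y ↔
      (x < y ∧ ¬ ((x : ℕ) = i ∧ (y : ℕ) = i + 1)) ∨ ((x : ℕ) = i + 1 ∧ (y : ℕ) = i) := by
  simp only [adjT, Equiv.swap_apply_def, Fin.ext_iff, Fin.lt_def]
  split_ifs <;> simp_all <;> omega

theorem blockInv_adjT_mul {n : ℕ} (ρ : Fin n → ℕ) (w : Equiv.Perm (Fin n)) {i : ℕ}
    (h : i + 1 < n) (hρ : ρ ⟨i, Nat.lt_of_succ_lt h⟩ = ρ ⟨i + 1, h⟩)
    (hw : w⁻¹ ⟨i, Nat.lt_of_succ_lt h⟩ < w⁻¹ ⟨i + 1, h⟩) :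
    blockInv ρ (adjT i h * w) = blockInv ρ w + 1 := by
  have hs := mem_fiberPerms.1 (adjT_mem_fiberPerms h hρ)
  set A := w⁻¹ ⟨i, Nat.lt_of_succ_lt h⟩ with hA
  set B := w⁻¹ ⟨i + 1, h⟩ with hB
  have hwA : w A = ⟨i, Nat.lt_of_succ_lt h⟩ := by simp [hA]
  have hwB : w B = ⟨i + 1, h⟩ := by simp [hB]
  unfold blockInv
  rw [← Finset.card_insert_of_notMem (a := (A, B))]
  · congr 1
    ext ⟨a, b⟩
    simp only [Finset.mem_filter, Finset.mem_univ, true_and, Equiv.Perm.mul_apply,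
      Finset.mem_insert, Prod.mk.injEq, hs, adjT_lt_adjT_iff]
    have ha : ((w a : Fin n) : ℕ) = i → a = A := fun e => by
      rw [hA, Equiv.Perm.eq_inv_iff_eq]; exact Fin.ext e
    have hb : ((w b : Fin n) : ℕ) = i + 1 → b = B := fun e => by
      rw [hB, Equiv.Perm.eq_inv_iff_eq]; exact Fin.ext e
    have ha' : ((w a : Fin n) : ℕ) = i + 1 → a = B := fun e => by
      rw [hB, Equiv.Perm.eq_inv_iff_eq]; exact Fin.ext e
    have hb' : ((w b : Fin n) : ℕ) = i → b = A := fun e => by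
      rw [hA, Equiv.Perm.eq_inv_iff_eq]; exact Fin.ext e
    constructor
    · rintro ⟨h1, (⟨h2, h3⟩ | ⟨h2, h3⟩), h4⟩
      · exact Or.inr ⟨h1, h2, h4⟩
      · exact Or.inl ⟨ha h3, hb h2⟩
    · rintro (⟨rfl, rfl⟩ | ⟨h1, h2, h4⟩)
      · exact ⟨hw, Or.inr ⟨by rw [hwB], by rw [hwA]⟩, by rw [hwA, hwB, hρ]⟩
      · refine ⟨h1, Or.inl ⟨h2, ?_⟩, h4⟩
        rintro ⟨h5, h6⟩
        rw [hb' h5, ha' h6] at h1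
        exact absurd h1 hw.not_gt
  · simp only [Finset.mem_filter, not_and]
    intro _ _ h2
    rw [hwA, hwB, Fin.lt_def] at h2
    simp at h2

theorem blockInv_adjT_mul' {n : ℕ} (ρ : Fin n → ℕ) (w : Equiv.Perm (Fin n)) {i : ℕ}
    (h : i + 1 < n) (hρ : ρ ⟨i, Nat.lt_of_succ_lt h⟩ = ρ ⟨i + 1, h⟩)
    (hw : w⁻¹ ⟨i + 1, h⟩ < w⁻¹ ⟨i, Nat.lt_of_succ_lt h⟩) :
    blockInv ρ w = blockInv ρ (adjT i h * w) + 1 := by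
  rw [← blockInv_adjT_mul ρ (adjT i h * w) h hρ, adjT_mul_cancel]
  simpa [adjT, mul_inv_rev] using hw

theorem fiberMin_of_adjacent {n : ℕ} {ρ : Fin n → ℕ} (hρ : Monotone ρ)
    {w : Equiv.Perm (Fin n)}
    (hw : ∀ (i : ℕ) (h : i + 1 < n), ρ ⟨i, Nat.lt_of_succ_lt h⟩ = ρ ⟨i + 1, h⟩ →
      w⁻¹ ⟨i, Nat.lt_of_succ_lt h⟩ < w⁻¹ ⟨i + 1, h⟩) : FiberMin ρ w := by
  have key : ∀ (k i : ℕ) (h : i + (k + 1) < n), ρ ⟨i, by omega⟩ = ρ ⟨i + (k + 1), h⟩ →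
      w⁻¹ ⟨i, by omega⟩ < w⁻¹ ⟨i + (k + 1), h⟩ := by
    intro k
    induction k with
    | zero => intro i h e; exact hw i h e
    | succ k ih =>
      intro i h e
      have h1 : ρ ⟨i, by omega⟩ ≤ ρ ⟨i + (k + 1), by omega⟩ := hρ (by simp)
      have h2 : ρ ⟨i + (k + 1), by omega⟩ ≤ ρ ⟨i + (k + 1 + 1), h⟩ :=
        hρ (by rw [Fin.le_def]; simp)
      exact (ih i (by omega) (by omega)).trans (hw (i + (k + 1)) h (by
        have : (⟨i + (k + 1) + 1, h⟩ : Fin n) = ⟨i + (k + 1 + 1), h⟩ := rfl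
        rw [this]; omega))
  intro a b hab e
  by_contra hlt
  have hne : w a ≠ w b := fun h => hab.ne (w.injective h)
  have hlt' : w b < w a := lt_of_le_of_ne (not_lt.1 hlt) hne.symm
  obtain ⟨k, hk⟩ : ∃ k, ((w a : Fin n) : ℕ) = (w b : Fin n) + (k + 1) :=
    ⟨(w a : ℕ) - (w b : ℕ) - 1, by rw [Fin.lt_def] at hlt'; omega⟩
  have hk' : w a = ⟨(w b : Fin n) + (k + 1), by rw [← hk]; exact (w a).2⟩ := Fin.ext hk
  have := key k (w b) (by rw [← hk]; exact (w a).2) (by rw [← hk', Fin.eta, e])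
  rw [← hk', Fin.eta, Equiv.Perm.coe_inv, Equiv.symm_apply_apply,
    Equiv.symm_apply_apply] at this
  exact absurd this hab.not_gt

theorem blockInv_eq_zero_iff {n : ℕ} {ρ : Fin n → ℕ} {w : Equiv.Perm (Fin n)} :
    blockInv ρ w = 0 ↔ FiberMin ρ w := by
  rw [blockInv, Finset.card_eq_zero, Finset.filter_eq_empty_iff]
  constructor
  · intro h a b hab e
    have := @h (a, b) (Finset.mem_univ _)
    simp only [not_and] at this
    exact lt_of_le_of_ne (not_lt.1 fun hl => this hab hl e) fun e' => hab.ne (w.injective e')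
  · rintro h ⟨a, b⟩ - ⟨h1, h2, h3⟩
    exact absurd (h a b h1 h3) h2.not_gt

theorem exists_block_descent {n : ℕ} {ρ : Fin n → ℕ} (hρ : Monotone ρ)
    {w : Equiv.Perm (Fin n)} (hw : ¬ FiberMin ρ w) :
    ∃ (i : ℕ) (h : i + 1 < n), ρ ⟨i, Nat.lt_of_succ_lt h⟩ = ρ ⟨i + 1, h⟩ ∧
      w⁻¹ ⟨i + 1, h⟩ < w⁻¹ ⟨i, Nat.lt_of_succ_lt h⟩ := by
  by_contra! hc
  refine hw (fiberMin_of_adjacent hρ fun i h e => lt_of_le_of_ne (hc i h e) fun e' => ?_)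
  have := w⁻¹.injective e'
  simp at this

theorem eq_one_of_fiberMin {n : ℕ} {w : Equiv.Perm (Fin n)} (hw : FiberMin (fun _ => 0) w) :
    w = 1 := by
  have h : StrictMono w := fun a b hab => hw a b hab rfl
  have h2 : Monotone w := h.monotone
  rwa [Equiv.Perm.monotone_iff] at h2

/-- The permutation `g` with `ρ ∘ g = ρ ∘ w` whose inverse is increasing on fibres of `ρ`. -/
def minRep {n : ℕ} (ρ : Fin n → ℕ) (w : Equiv.Perm (Fin n)) : Equiv.Perm (Fin n) :=
  (Tuple.sort (ρ ∘ w))⁻¹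

theorem comp_minRep {n : ℕ} {ρ : Fin n → ℕ} (hρ : Monotone ρ) (w : Equiv.Perm (Fin n))
    (a : Fin n) : ρ (minRep ρ w a) = ρ (w a) := by
  have h := Tuple.unique_monotone (f := ρ ∘ w) (σ := Tuple.sort (ρ ∘ w)) (τ := w⁻¹)
    (Tuple.monotone_sort _) (by
      have : (ρ ∘ w) ∘ (w⁻¹ : Equiv.Perm (Fin n)) = ρ := by ext; simp
      rwa [this])
  have h2 := congrFun h (minRep ρ w a)
  simpa [minRep] using h2.symm

theorem fiberMin_minRep {n : ℕ} {ρ : Fin n → ℕ} (hρ : Monotone ρ)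
    (w : Equiv.Perm (Fin n)) : FiberMin ρ (minRep ρ w) := by
  intro a b hab e
  have h := ((Tuple.eq_sort_iff (f := ρ ∘ w)).1 rfl).2
  by_contra hlt
  have hlt' : minRep ρ w b < minRep ρ w a :=
    lt_of_le_of_ne (not_lt.1 hlt) fun e' => hab.ne ((minRep ρ w).injective e').symm
  rw [comp_minRep hρ, comp_minRep hρ] at e
  have := h _ _ hlt' (by simpa [minRep] using e.symm)
  simp only [minRep, Equiv.Perm.coe_inv, Equiv.apply_symm_apply] at this
  exact absurd this hab.not_gt

theorem eq_minRep {n : ℕ} {ρ : Fin n → ℕ} (hρ : Monotone ρ) {g w : Equiv.Perm (Fin n)}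
    (hg : FiberMin ρ g) (h : ∀ a, ρ (g a) = ρ (w a)) : g = minRep ρ w := by
  have hfun : ρ ∘ w = ρ ∘ g := funext fun a => (h a).symm
  rw [minRep, ← inv_inj, inv_inv, Tuple.eq_sort_iff, hfun]
  refine ⟨?_, fun i j hij e => ?_⟩
  · have : (ρ ∘ g) ∘ (g⁻¹ : Equiv.Perm (Fin n)) = ρ := by ext; simp
    rwa [this]
  · by_contra hlt
    have hlt' : g⁻¹ j < g⁻¹ i :=
      lt_of_le_of_ne (not_lt.1 hlt) fun e' => hij.ne (g⁻¹.injective e').symm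
    have := hg _ _ hlt' (by simpa using e.symm)
    simp only [Equiv.Perm.coe_inv, Equiv.apply_symm_apply] at this
    exact absurd this hij.not_gt

/-! ### Multiplication in the Hecke algebra -/

section Hecke

variable {F : Type*} [Field F] {H : Type*} [Ring H] [Algebra F H] {n : ℕ} {q : F}
  {T : Equiv.Perm (Fin n) → H}

theorem IsHeckeBasis.mul_adjT (hT : IsHeckeBasis q T) (w : Equiv.Perm (Fin n)) {i : ℕ}
    (h : i + 1 < n) (hw : w⁻¹ ⟨i, Nat.lt_of_succ_lt h⟩ < w⁻¹ ⟨i + 1, h⟩) :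
    T w * T (adjT i h) = T (adjT i h * w) := by
  refine hT.mul_adj_asc w i h ?_
  rw [permLength_eq_blockInv, permLength_eq_blockInv, blockInv_adjT_mul _ w h rfl hw]
  exact Nat.lt_succ_self _

theorem IsHeckeBasis.adjT_mul_self (hT : IsHeckeBasis q T) {i : ℕ} (h : i + 1 < n) :
    T (adjT i h) * T (adjT i h) = q • 1 + (q - 1) • T (adjT i h) := by
  have := hT.mul_adj_desc (adjT i h) i h (by
    rw [permLength_eq_blockInv, permLength_eq_blockInv,
      blockInv_adjT_mul' _ (adjT i h) h rfl (by simp [adjT])]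
    exact Nat.lt_succ_self _)
  rwa [FayersSemistd.adjT_mul_self, hT.one] at this

theorem IsHeckeBasis.adjT_mul (hT : IsHeckeBasis q T) {i : ℕ} (h : i + 1 < n)
    (w : Equiv.Perm (Fin n)) (hw : w ⟨i, Nat.lt_of_succ_lt h⟩ < w ⟨i + 1, h⟩) :
    T (adjT i h) * T w = T (w * adjT i h) := by
  induction hk : blockInv (fun _ => 0) w generalizing w with
  | zero =>
    rw [eq_one_of_fiberMin (blockInv_eq_zero_iff.1 hk), hT.one, mul_one, one_mul]
  | succ k ih =>
    obtain ⟨j, hj, -, hdesc⟩ := exists_block_descent (ρ := fun _ => 0) monotone_const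
      (w := w) (fun hm => by rw [blockInv_eq_zero_iff.2 hm] at hk; omega)
    have hlen := blockInv_adjT_mul' (fun _ => 0) w hj rfl hdesc
    set w' := adjT j hj * w with hw'
    have hww' : w = adjT j hj * w' := by rw [hw', adjT_mul_cancel]
    have hasc : w'⁻¹ ⟨j, Nat.lt_of_succ_lt hj⟩ < w'⁻¹ ⟨j + 1, hj⟩ := by
      simpa [hw', adjT, mul_inv_rev] using hdesc
    clear_value w'
    have hw1 : w' ⟨i, Nat.lt_of_succ_lt h⟩ < w' ⟨i + 1, h⟩ := by
      rw [hw', Equiv.Perm.mul_apply, Equiv.Perm.mul_apply, adjT_lt_adjT_iff]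
      refine Or.inl ⟨hw, ?_⟩
      rintro ⟨h1, h2⟩
      have e1 : w⁻¹ ⟨j, Nat.lt_of_succ_lt hj⟩ = ⟨i, Nat.lt_of_succ_lt h⟩ := by
        rw [Equiv.Perm.inv_eq_iff_eq]; exact Fin.ext h1.symm
      have e2 : w⁻¹ ⟨j + 1, hj⟩ = ⟨i + 1, h⟩ := by
        rw [Equiv.Perm.inv_eq_iff_eq]; exact Fin.ext h2.symm
      rw [e1, e2, Fin.lt_def] at hdesc
      simp at hdesc
    have hasc2 : (w' * adjT i h)⁻¹ ⟨j, Nat.lt_of_succ_lt hj⟩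
        < (w' * adjT i h)⁻¹ ⟨j + 1, hj⟩ := by
      have e : (adjT i h)⁻¹ = adjT i h := Equiv.swap_inv _ _
      rw [mul_inv_rev, e, Equiv.Perm.mul_apply, Equiv.Perm.mul_apply, adjT_lt_adjT_iff]
      refine Or.inl ⟨hasc, ?_⟩
      rintro ⟨h1, h2⟩
      have e1 : w' ⟨i, Nat.lt_of_succ_lt h⟩ = ⟨j, Nat.lt_of_succ_lt hj⟩ :=
        (Equiv.Perm.inv_eq_iff_eq.1 (Fin.ext h1)).symm
      have e2 : w' ⟨i + 1, h⟩ = ⟨j + 1, hj⟩ :=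
        (Equiv.Perm.inv_eq_iff_eq.1 (Fin.ext h2)).symm
      rw [hww', Equiv.Perm.mul_apply, Equiv.Perm.mul_apply, e1, e2, adjT_lt_adjT_iff] at hw
      simp at hw
    rw [hww', ← hT.mul_adjT w' hj hasc, ← mul_assoc, ih w' hw1 (by omega),
      hT.mul_adjT _ hj hasc2, ← mul_assoc]

/-- The sum of the `T v` over the permutations `v` preserving the fibres of `ρ`. -/
def fiberSum (T : Equiv.Perm (Fin n) → H) (ρ : Fin n → ℕ) : H := ∑ v ∈ fiberPerms ρ, T v

theorem IsHeckeBasis.adjT_mul_fiberSum (hT : IsHeckeBasis q T) {ρ : Fin n → ℕ} {i : ℕ}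
    (h : i + 1 < n) (hρ : ρ ⟨i, Nat.lt_of_succ_lt h⟩ = ρ ⟨i + 1, h⟩) :
    T (adjT i h) * fiberSum T ρ = q • fiberSum T ρ := by
  have hs := adjT_mem_fiberPerms h hρ
  have hsum : fiberSum T ρ = ∑ v ∈ (fiberPerms ρ).filter
      (fun v => v ⟨i, Nat.lt_of_succ_lt h⟩ < v ⟨i + 1, h⟩), (T v + T (adjT i h) * T v) := by
    rw [fiberSum, ← Finset.sum_filter_add_sum_filter_not _
      (fun v => v ⟨i, Nat.lt_of_succ_lt h⟩ < v ⟨i + 1, h⟩), Finset.sum_add_distrib]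
    congr 1
    refine Finset.sum_bij' (fun v _ => v * adjT i h) (fun v _ => v * adjT i h) ?_ ?_ ?_ ?_ ?_
    · intro v hv
      rw [Finset.mem_filter] at hv ⊢
      refine ⟨mul_mem_fiberPerms hv.1 hs, ?_⟩
      have hne : v ⟨i + 1, h⟩ ≠ v ⟨i, Nat.lt_of_succ_lt h⟩ := fun e => by
        have := v.injective e
        simp at this
      simpa [adjT] using lt_of_le_of_ne (not_lt.1 hv.2) hne
    · intro v hv
      rw [Finset.mem_filter] at hv ⊢
      refine ⟨mul_mem_fiberPerms hv.1 hs, ?_⟩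
      simpa [adjT] using hv.2.le
    · intro v _
      exact mul_adjT_cancel h v
    · intro v _
      exact mul_adjT_cancel h v
    · intro v hv
      rw [Finset.mem_filter] at hv
      rw [hT.adjT_mul h (v * adjT i h), mul_adjT_cancel]
      have hne : v ⟨i + 1, h⟩ ≠ v ⟨i, Nat.lt_of_succ_lt h⟩ := fun e => by
        have := v.injective e
        simp at this
      simpa [adjT] using lt_of_le_of_ne (not_lt.1 hv.2) hne
  rw [hsum, Finset.mul_sum, Finset.smul_sum]
  refine Finset.sum_congr rfl fun v _ => ?_
  rw [mul_add, ← mul_assoc, hT.adjT_mul_self, add_mul, smul_mul_assoc, one_mul, smul_mul_assoc,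
    smul_add, sub_smul, one_smul]
  abel

theorem IsHeckeBasis.mul_of_fiberMin (hT : IsHeckeBasis q T) {ρ : Fin n → ℕ}
    (hρ : Monotone ρ) {g : Equiv.Perm (Fin n)} (hg : FiberMin ρ g) {v : Equiv.Perm (Fin n)}
    (hv : v ∈ fiberPerms ρ) : T g * T v = T (v * g) := by
  induction hk : blockInv ρ v generalizing v with
  | zero =>
    have hv1 : v = 1 := by
      have h1 := eq_minRep hρ (blockInv_eq_zero_iff.1 hk) (w := 1)
        (fun a => mem_fiberPerms.1 hv a)
      have h2 := eq_minRep hρ (g := 1) (w := 1) (fun a b hab _ => hab) (fun _ => rfl)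
      rw [h1, ← h2]
    rw [hv1, hT.one, mul_one, one_mul]
  | succ k ih =>
    obtain ⟨j, hj, hρj, hdesc⟩ := exists_block_descent hρ
      (w := v) (fun hm => by rw [blockInv_eq_zero_iff.2 hm] at hk; omega)
    have hlen := blockInv_adjT_mul' ρ v hj hρj hdesc
    set v' := adjT j hj * v with hv'
    have hvv' : v = adjT j hj * v' := by rw [hv', adjT_mul_cancel]
    have hv'm : v' ∈ fiberPerms ρ := mul_mem_fiberPerms (adjT_mem_fiberPerms hj hρj) hv
    have hasc : v'⁻¹ ⟨j, Nat.lt_of_succ_lt hj⟩ < v'⁻¹ ⟨j + 1, hj⟩ := by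
      simpa [hv', adjT, mul_inv_rev] using hdesc
    clear_value v'
    have hasc2 : (v' * g)⁻¹ ⟨j, Nat.lt_of_succ_lt hj⟩ < (v' * g)⁻¹ ⟨j + 1, hj⟩ := by
      rw [mul_inv_rev, Equiv.Perm.mul_apply, Equiv.Perm.mul_apply]
      have hi := mem_fiberPerms.1 (inv_mem_fiberPerms hv'm)
      by_contra hlt
      have hne := fun e => hasc.ne (g⁻¹.injective e)
      have := hg _ _ (lt_of_le_of_ne (not_lt.1 hlt) (Ne.symm hne)) (by
        simp only [Equiv.Perm.coe_inv, Equiv.apply_symm_apply]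
        simp only [Equiv.Perm.coe_inv] at hi
        rw [hi, hi, hρj])
      simp only [Equiv.Perm.coe_inv, Equiv.apply_symm_apply] at this
      exact absurd this hasc.not_gt
    rw [hvv', ← hT.mul_adjT v' hj hasc, ← mul_assoc, ih hv'm (by omega),
      hT.mul_adjT _ hj hasc2, ← mul_assoc]

theorem IsHeckeBasis.mul_fiberSum (hT : IsHeckeBasis q T) {ρ : Fin n → ℕ}
    (hρ : Monotone ρ) (g : Equiv.Perm (Fin n)) :
    T g * fiberSum T ρ = q ^ blockInv ρ g • ∑ v ∈ fiberPerms ρ, T (v * g) := by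
  induction hk : blockInv ρ g generalizing g with
  | zero =>
    rw [pow_zero, one_smul, fiberSum, Finset.mul_sum]
    exact Finset.sum_congr rfl fun v hv =>
      hT.mul_of_fiberMin hρ (blockInv_eq_zero_iff.1 hk) hv
  | succ k ih =>
    obtain ⟨j, hj, hρj, hdesc⟩ := exists_block_descent hρ
      (w := g) (fun hm => by rw [blockInv_eq_zero_iff.2 hm] at hk; omega)
    have hlen := blockInv_adjT_mul' ρ g hj hρj hdesc
    have hs := adjT_mem_fiberPerms hj hρj
    set g' := adjT j hj * g with hg'
    have hgg' : g = adjT j hj * g' := by rw [hg', adjT_mul_cancel]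
    have hasc : g'⁻¹ ⟨j, Nat.lt_of_succ_lt hj⟩ < g'⁻¹ ⟨j + 1, hj⟩ := by
      simpa [hg', adjT, mul_inv_rev] using hdesc
    have hT' : T g = T g' * T (adjT j hj) := by rw [hT.mul_adjT g' hj hasc, ← hgg']
    rw [hT', mul_assoc, hT.adjT_mul_fiberSum hj hρj, mul_smul_comm, ih g' (by omega), smul_smul,
      ← pow_succ']
    congr 1
    refine Finset.sum_bij' (fun v _ => v * adjT j hj) (fun v _ => v * adjT j hj) ?_ ?_ ?_ ?_ ?_
    · exact fun v hv => mul_mem_fiberPerms hv hs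
    · exact fun v hv => mul_mem_fiberPerms hv hs
    · exact fun v _ => mul_adjT_cancel hj v
    · exact fun v _ => mul_adjT_cancel hj v
    · intro v _
      rw [hg', mul_assoc]

/-- A sum of `T w` over a set stable under left multiplication by the permutations preserving
the fibres of `ρ` is a left multiple of `fiberSum T ρ`. -/
theorem IsHeckeBasis.sum_eq_mul_fiberSum (hT : IsHeckeBasis q T) {ρ : Fin n → ℕ}
    (hρ : Monotone ρ) (D : Finset (Equiv.Perm (Fin n)))
    (hD : ∀ v ∈ fiberPerms ρ, ∀ w ∈ D, v * w ∈ D) :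
    ∑ w ∈ D, T w = (∑ g ∈ D.filter (FiberMin ρ), T g) * fiberSum T ρ := by
  rw [fiberSum, Finset.sum_mul_sum, ← Finset.sum_product']
  symm
  have hmem : ∀ w, w * (minRep ρ w)⁻¹ ∈ fiberPerms ρ := by
    intro w
    rw [mem_fiberPerms]
    intro p
    rw [Equiv.Perm.mul_apply, ← comp_minRep hρ, Equiv.Perm.coe_inv, Equiv.apply_symm_apply]
  refine Finset.sum_bij' (fun p _ => p.2 * p.1) (fun w _ => (minRep ρ w, w * (minRep ρ w)⁻¹))
    ?_ ?_ ?_ ?_ ?_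
  · rintro ⟨g, v⟩ h
    rw [Finset.mem_product, Finset.mem_filter] at h
    exact hD _ h.2 _ h.1.1
  · intro w hw
    rw [Finset.mem_product, Finset.mem_filter]
    refine ⟨⟨?_, fiberMin_minRep hρ w⟩, hmem w⟩
    have := hD _ (inv_mem_fiberPerms (hmem w)) w hw
    simpa [mul_inv_rev, mul_assoc] using this
  · rintro ⟨g, v⟩ h
    rw [Finset.mem_product, Finset.mem_filter] at h
    have hg : minRep ρ (v * g) = g := by
      refine (eq_minRep hρ h.1.2 fun a => ?_).symm
      rw [Equiv.Perm.mul_apply, mem_fiberPerms.1 h.2]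
    simp only [hg, mul_inv_cancel_right]
  · intro w _
    simp
  · rintro ⟨g, v⟩ h
    rw [Finset.mem_product, Finset.mem_filter] at h
    exact hT.mul_of_fiberMin hρ h.1.2 h.2

end Hecke

/-! ### Gaussian binomial coefficients and sums over subsets -/

section Gaussian

variable {F : Type*} [Field F] (q : F)

theorem qBinom_zero_right (a : ℕ) : qBinom q a 0 = 1 := by
  cases a <;> rfl

theorem qBinom_succ_succ (a b : ℕ) :
    qBinom q (a + 1) (b + 1) = qBinom q a b + q ^ (b + 1) * qBinom q a (b + 1) := rfl

theorem qBinom_eq_zero_of_lt {a b : ℕ} (h : a < b) : qBinom q a b = 0 := by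
  induction a generalizing b with
  | zero =>
    cases b with
    | zero => omega
    | succ b => rfl
  | succ a ih =>
    cases b with
    | zero => omega
    | succ b => rw [qBinom_succ_succ, ih (by omega), ih (by omega), mul_zero, add_zero]

theorem qBinom_self (a : ℕ) : qBinom q a a = 1 := by
  induction a with
  | zero => rfl
  | succ a ih =>
    rw [qBinom_succ_succ, ih, qBinom_eq_zero_of_lt q (Nat.lt_succ_self a), mul_zero, add_zero]

/-- The second form of the `q`-Pascal recurrence. -/
theorem qBinom_add_succ_succ (a b : ℕ) :
    qBinom q (a + b + 2) (a + 1)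
      = q ^ (b + 1) * qBinom q (a + b + 1) a + qBinom q (a + b + 1) (a + 1) := by
  induction hk : a + b generalizing a b with
  | zero =>
    obtain ⟨rfl, rfl⟩ : a = 0 ∧ b = 0 := by omega
    simp [qBinom, add_comm]
  | succ k ih =>
    rw [qBinom_succ_succ q (k + 1 + 1) a]
    rcases a with _ | a
    · obtain rfl : b = k + 1 := by omega
      have h := ih 0 k (by omega)
      rw [qBinom_succ_succ q (k + 1) 0] at h ⊢
      simp only [qBinom_zero_right] at h ⊢
      linear_combination q * h
    · rcases b with _ | b
      · obtain rfl : k = a := by omega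
        have h := ih k 0 (by omega)
        have hd := qBinom_succ_succ q (k + 1) k
        rw [qBinom_self] at h hd ⊢
        linear_combination h - q * hd
      · have h1 := ih a (b + 1) (by omega)
        have h2 := ih (a + 1) b (by omega)
        have d1 := qBinom_succ_succ q (k + 1) a
        have d2 := qBinom_succ_succ q (k + 1) (a + 1)
        linear_combination h1 + q ^ (a + 2) * h2 - q ^ (b + 2) * d1 - d2

theorem qBinom_symm_add (a b : ℕ) : qBinom q (a + b) a = qBinom q (a + b) b := by
  induction hk : a + b generalizing a b with
  | zero =>
    obtain ⟨rfl, rfl⟩ : a = 0 ∧ b = 0 := by omega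
    rfl
  | succ k ih =>
    rcases a with _ | a
    · obtain rfl : b = k + 1 := by omega
      rw [qBinom_zero_right, qBinom_self]
    · rcases b with _ | b
      · obtain rfl : k = a := by omega
        rw [qBinom_zero_right, qBinom_self]
      · obtain rfl : k = a + b + 1 := by omega
        rw [qBinom_add_succ_succ q a b, qBinom_succ_succ q (a + b + 1) b, ih a (b + 1) (by omega),
          ih (a + 1) b (by omega), add_comm]

theorem qBinomProd_symm (A B : Multiset ℕ) : qBinomProd q A B = qBinomProd q B A := by
  unfold qBinomProd
  rw [add_comm B A]
  refine Finset.prod_congr rfl fun i _ => ?_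
  rw [Multiset.count_add, qBinom_symm_add]

theorem qBinomProd_eq (k : ℕ) (A B : Multiset ℕ) :
    qBinomProd q A B = qBinom q (A.count k + B.count k) (A.count k)
      * qBinomProd q (A.filter (· ≠ k)) (B.filter (· ≠ k)) := by
  have hext : ∀ (A B : Multiset ℕ) (s : Finset ℕ), (A + B).toFinset ⊆ s →
      qBinomProd q A B = ∏ i ∈ s, qBinom q (A.count i + B.count i) (A.count i) := by
    intro A B s hs
    rw [qBinomProd, Finset.prod_subset hs]
    · simp only [Multiset.count_add]
    · intro i _ hi
      have h0 : (A + B).count i = 0 := Multiset.count_eq_zero.2 (by simpa using hi)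
      rw [h0]
      rw [Multiset.count_add] at h0
      rw [(by omega : A.count i = 0)]
      rfl
  have hk := Finset.mem_insert_self k (A + B).toFinset
  have hsub : (A.filter (· ≠ k) + B.filter (· ≠ k)).toFinset
      ⊆ insert k (A + B).toFinset := by
    intro i
    simp only [Multiset.mem_toFinset, Multiset.mem_add, Multiset.mem_filter, Finset.mem_insert]
    tauto
  rw [hext A B _ (Finset.subset_insert k _), hext _ _ _ hsub, ← Finset.mul_prod_erase _ _ hk,
    ← Finset.mul_prod_erase (insert k (A + B).toFinset)
      (fun i => qBinom q ((A.filter (· ≠ k)).count i + (B.filter (· ≠ k)).count i)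
        ((A.filter (· ≠ k)).count i)) hk]
  simp only [Multiset.count_filter, ne_eq, not_true_eq_false, if_false, add_zero,
    qBinom_zero_right, one_mul]
  congr 1
  refine Finset.prod_congr rfl fun i hi => ?_
  rw [if_pos (Finset.ne_of_mem_erase hi), if_pos (Finset.ne_of_mem_erase hi)]

theorem invPairs_cons_left {k : ℕ} {A B : Multiset ℕ} (hB : ∀ x ∈ B, k ≤ x) :
    invPairs (k ::ₘ A) B = invPairs A B := by
  have h : (k ::ₘ A).product B = B.map (Prod.mk k) + A.product B := Multiset.cons_product _ _ _
  rw [invPairs, h, Multiset.filter_add, Multiset.card_add]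
  have h0 : (B.map (Prod.mk k)).filter (fun p => p.2 < p.1) = 0 := by
    rw [Multiset.filter_eq_nil]
    intro p hp
    obtain ⟨x, hx, rfl⟩ := Multiset.mem_map.1 hp
    exact (hB x hx).not_gt
  rw [h0, Multiset.card_zero, zero_add, invPairs]

theorem invPairs_cons_right {k : ℕ} {A B : Multiset ℕ} (hA : ∀ x ∈ A, k ≤ x) :
    invPairs A (k ::ₘ B) + A.count k = invPairs A B + A.card := by
  have h : A.product (k ::ₘ B) = A.map (fun a => (a, k)) + A.product B :=
    Multiset.product_cons _ _ _
  rw [invPairs, h, Multiset.filter_add, Multiset.card_add, Multiset.filter_map, Multiset.card_map,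
    ← Multiset.countP_eq_card_filter, Multiset.count]
  have h1 := Multiset.card_eq_countP_add_countP (k < ·) A
  have h2 : A.countP (fun x => ¬ k < x) = A.countP (k = ·) := by
    refine Multiset.countP_congr rfl fun x hx => ?_
    have := hA x hx
    exact propext ⟨fun h => by omega, fun h => by omega⟩
  have h3 : A.countP ((fun p : ℕ × ℕ => p.2 < p.1) ∘ fun a => (a, k)) = A.countP (k < ·) := rfl
  rw [h3, ← h2, h1, invPairs]
  ring

/-- The number of pairs in `J × K` whose second entry is smaller than the first. -/
def invFinset {n : ℕ} (J K : Finset (Fin n)) : ℕ :=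
  ((J ×ˢ K).filter (fun p => p.2 < p.1)).card

theorem invFinset_insert_left {n : ℕ} {a : Fin n} {J K : Finset (Fin n)}
    (hK : ∀ x ∈ K, a < x) : invFinset (insert a J) K = invFinset J K := by
  unfold invFinset
  congr 1
  ext ⟨x, y⟩
  simp only [Finset.mem_filter, Finset.mem_product, Finset.mem_insert]
  constructor
  · rintro ⟨⟨rfl | hx, hy⟩, hlt⟩
    · exact absurd hlt (hK y hy).not_gt
    · exact ⟨⟨hx, hy⟩, hlt⟩
  · rintro ⟨⟨hx, hy⟩, hlt⟩
    exact ⟨⟨Or.inr hx, hy⟩, hlt⟩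

theorem invFinset_insert_right {n : ℕ} {a : Fin n} {J K : Finset (Fin n)} (haK : a ∉ K)
    (hJ : ∀ x ∈ J, a < x) : invFinset J (insert a K) = invFinset J K + J.card := by
  unfold invFinset
  have h : (J ×ˢ insert a K).filter (fun p => p.2 < p.1)
      = (J ×ˢ K).filter (fun p => p.2 < p.1) ∪ J.image (fun x => (x, a)) := by
    ext ⟨x, y⟩
    simp only [Finset.mem_filter, Finset.mem_product, Finset.mem_insert, Finset.mem_union,
      Finset.mem_image, Prod.mk.injEq]
    constructor
    · rintro ⟨⟨hx, rfl | hy⟩, hlt⟩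
      · exact Or.inr ⟨x, hx, rfl, rfl⟩
      · exact Or.inl ⟨⟨hx, hy⟩, hlt⟩
    · rintro (⟨⟨hx, hy⟩, hlt⟩ | ⟨x', hx, rfl, rfl⟩)
      · exact ⟨⟨hx, Or.inr hy⟩, hlt⟩
      · exact ⟨⟨hx, Or.inl rfl⟩, hJ _ hx⟩
  rw [h, Finset.card_union_of_disjoint, Finset.card_image_of_injective]
  · exact fun x y hxy => (Prod.mk.inj hxy).1
  · rw [Finset.disjoint_left]
    rintro ⟨x, y⟩ h1 h2
    simp only [Finset.mem_filter, Finset.mem_product, Finset.mem_image, Prod.mk.injEq] at h1 h2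
    obtain ⟨_, _, _, rfl⟩ := h2
    exact haK h1.1.2

theorem sum_powerset_eq_zero {n : ℕ} (c : Fin n → ℕ) (P : Finset (Fin n)) {R : Multiset ℕ}
    (hR : ¬ R ≤ P.val.map c) :
    ∑ J ∈ P.powerset.filter (fun J => J.val.map c = R), q ^ invFinset J (P \ J) = 0 := by
  refine Finset.sum_eq_zero fun J hJ => ?_
  rw [Finset.mem_filter, Finset.mem_powerset] at hJ
  exact absurd (hJ.2 ▸ Multiset.map_le_map (Finset.val_le_iff.2 hJ.1)) hR

/-- The sum of `q ^ inv` over the subsets of `P` whose multiset of colours is `R`, for a weakly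
increasing colouring. -/
theorem sum_powerset_pow_invFinset {n : ℕ} {c : Fin n → ℕ} (hc : Monotone c)
    (P : Finset (Fin n)) (R U : Multiset ℕ) (hP : P.val.map c = R + U) :
    ∑ J ∈ P.powerset.filter (fun J => J.val.map c = R), q ^ invFinset J (P \ J)
      = qBinomProd q R U * q ^ invPairs R U := by
  induction P using Finset.induction_on_min generalizing R U with
  | empty =>
    have h0 : R + U = 0 := by rw [← hP]; rfl
    obtain ⟨rfl, rfl⟩ : R = 0 ∧ U = 0 := by simpa using h0
    simp [Finset.filter_singleton, qBinomProd, invPairs, invFinset, Multiset.product]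
  | insert a P ha ih =>
    have haP : a ∉ P := fun h => (ha a h).false
    have hP' : c a ::ₘ P.val.map c = R + U := by
      rw [← hP, Finset.insert_val_of_notMem haP, Multiset.map_cons]
    generalize hk : c a = k at hP'
    have hmin : ∀ x ∈ R + U, k ≤ x := by
      intro x hx
      rw [← hP', Multiset.mem_cons, Multiset.mem_map] at hx
      rcases hx with rfl | ⟨y, hy, rfl⟩
      · exact le_rfl
      · rw [← hk]; exact hc (ha y hy).le
    have hminR : ∀ x ∈ R, k ≤ x := fun x hx => hmin x (Multiset.mem_add.2 (Or.inl hx))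
    have hminU : ∀ x ∈ U, k ≤ x := fun x hx => hmin x (Multiset.mem_add.2 (Or.inr hx))
    have hfirst : ∑ J ∈ P.powerset, (if J.val.map c = R then q ^ invFinset J (insert a P \ J)
        else 0) = q ^ R.card * ∑ J ∈ P.powerset.filter (fun J => J.val.map c = R),
          q ^ invFinset J (P \ J) := by
      rw [Finset.sum_filter, Finset.mul_sum]
      refine Finset.sum_congr rfl fun J hJ => ?_
      have hJP := Finset.mem_powerset.1 hJ
      split_ifs with h
      · rw [Finset.insert_sdiff_of_notMem _ (fun h => haP (hJP h)),
          invFinset_insert_right (fun h => haP (Finset.mem_sdiff.1 h).1) (fun x hx => ha x (hJP hx)),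
          pow_add, mul_comm, ← h, Multiset.card_map, Finset.card_val]
      · rw [mul_zero]
    have hsecond : ∀ R', R = k ::ₘ R' →
        ∑ J ∈ P.powerset, (if (insert a J).val.map c = R then
          q ^ invFinset (insert a J) (insert a P \ insert a J) else 0)
        = ∑ J ∈ P.powerset.filter (fun J => J.val.map c = R'), q ^ invFinset J (P \ J) := by
      intro R' hR'
      rw [Finset.sum_filter]
      refine Finset.sum_congr rfl fun J hJ => ?_
      have hJP := Finset.mem_powerset.1 hJ
      refine if_congr ?_ ?_ rfl
      · rw [Finset.insert_val_of_notMem (fun h => haP (hJP h)), Multiset.map_cons, hk, hR',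
          Multiset.cons_inj_right]
      rw [Finset.insert_sdiff_insert, Finset.sdiff_insert_of_notMem haP,
        invFinset_insert_left (fun x hx => ha x (Finset.mem_sdiff.1 hx).1)]
    have hsecond0 : k ∉ R → ∑ J ∈ P.powerset, (if (insert a J).val.map c = R then
          q ^ invFinset (insert a J) (insert a P \ insert a J) else 0) = 0 := by
      intro hkR
      refine Finset.sum_eq_zero fun J hJ => if_neg fun h => hkR ?_
      rw [← h, Multiset.mem_map]
      exact ⟨a, Finset.mem_insert_self _ _, hk⟩
    rw [Finset.sum_filter, Finset.sum_powerset_insert haP, hfirst]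
    by_cases hkU : k ∈ U
    · obtain ⟨U', rfl⟩ := Multiset.exists_cons_of_mem hkU
      have hPU : P.val.map c = R + U' := by
        rw [Multiset.add_cons, Multiset.cons_inj_right] at hP'
        exact hP'
      have hinvU := invPairs_cons_right (B := U') hminR
      rw [ih R U' hPU]
      by_cases hkR : k ∈ R
      · obtain ⟨R', rfl⟩ := Multiset.exists_cons_of_mem hkR
        have hPR : P.val.map c = R' + (k ::ₘ U') := by
          rw [hPU, Multiset.cons_add, Multiset.add_cons]
        rw [hsecond R' rfl, ih R' _ hPR, qBinomProd_eq q k (k ::ₘ R') U',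
          qBinomProd_eq q k R' (k ::ₘ U'), qBinomProd_eq q k (k ::ₘ R') (k ::ₘ U'),
          ← invPairs_cons_left (A := R') hminU]
        simp only [Multiset.filter_cons_of_neg, ne_eq, not_true_eq_false, not_false_eq_true,
          Multiset.count_cons_self] at hinvU ⊢
        have e1 : R'.count k + 1 + (U'.count k + 1) = (R'.count k + U'.count k + 1) + 1 := by ring
        have e2 : R'.count k + 1 + U'.count k = R'.count k + U'.count k + 1 := by ring
        have e3 : R'.count k + (U'.count k + 1) = R'.count k + U'.count k + 1 := by ring
        rw [e1, e2, e3, qBinom_succ_succ q (R'.count k + U'.count k + 1)]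
        have hpow : q ^ (k ::ₘ R').card * q ^ invPairs (k ::ₘ R') U'
            = q ^ (R'.count k + 1) * q ^ invPairs (k ::ₘ R') (k ::ₘ U') := by
          rw [← pow_add, ← pow_add]
          congr 1
          omega
        linear_combination (qBinom q (R'.count k + U'.count k + 1) (R'.count k + 1) *
          qBinomProd q (R'.filter (¬ · = k)) (U'.filter (¬ · = k))) * hpow
      · rw [hsecond0 hkR, qBinomProd_eq q k R U', qBinomProd_eq q k R (k ::ₘ U')]
        rw [Multiset.count_eq_zero.2 hkR] at hinvU ⊢
        simp only [Multiset.filter_cons_of_neg, ne_eq, not_true_eq_false, not_false_eq_true,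
          qBinom_zero_right, add_zero, one_mul] at hinvU ⊢
        rw [hinvU, pow_add]
        ring
    · have hkR : k ∈ R := by
        have : k ∈ R + U := hP' ▸ Multiset.mem_cons_self _ _
        exact (Multiset.mem_add.1 this).resolve_right hkU
      obtain ⟨R', rfl⟩ := Multiset.exists_cons_of_mem hkR
      have hPR : P.val.map c = R' + U := by
        rw [Multiset.cons_add, Multiset.cons_inj_right] at hP'
        exact hP'
      have hnot : ¬ (k ::ₘ R') ≤ P.val.map c := by
        intro hle
        have := Multiset.count_le_of_le k hle
        rw [hPR, Multiset.count_add, Multiset.count_eq_zero.2 hkU, Multiset.count_cons_self] at this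
        omega
      rw [sum_powerset_eq_zero q c P hnot, mul_zero, zero_add, hsecond R' rfl, ih R' U hPR,
        qBinomProd_eq q k R' U, qBinomProd_eq q k (k ::ₘ R') U, invPairs_cons_left hminU,
        Multiset.count_eq_zero.2 hkU]
      simp only [Multiset.filter_cons_of_neg, ne_eq, not_true_eq_false, not_false_eq_true,
        add_zero, qBinom_self]

end Gaussian

/-! ### Rows, double cosets and row contents -/

theorem cumSum_mono (lam : ℕ → ℕ) : Monotone (cumSum lam) := fun _ _ h =>
  Finset.sum_le_sum_of_subset (Finset.range_subset_range.2 h)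

theorem cumSum_succ (lam : ℕ → ℕ) (i : ℕ) : cumSum lam (i + 1) = cumSum lam i + lam i :=
  Finset.sum_range_succ _ _

theorem IsComposition.cumSum_le {n : ℕ} {lam : ℕ → ℕ} (h : IsComposition n lam) (i : ℕ) :
    cumSum lam i ≤ n := by
  obtain ⟨N, hN, rfl⟩ := h
  rcases le_total i N with hi | hi
  · exact cumSum_mono lam hi
  · refine (Finset.sum_subset (Finset.range_subset_range.2 hi) fun x _ hx => hN x ?_).ge
    simpa using hx

theorem rowOf_eq {lam : ℕ → ℕ} {p r : ℕ} (h1 : cumSum lam r ≤ p) (h2 : p < cumSum lam (r + 1)) :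
    rowOf lam p = r := by
  refine le_antisymm (Nat.sInf_le h2) (le_csInf ⟨r, h2⟩ fun r' hr' => ?_)
  by_contra hlt
  exact absurd (hr'.trans_le (cumSum_mono lam (by omega : r' + 1 ≤ r))) (by omega)

theorem IsComposition.rowOf_spec {n : ℕ} {lam : ℕ → ℕ} (h : IsComposition n lam) {p : ℕ}
    (hp : p < n) : cumSum lam (rowOf lam p) ≤ p ∧ p < cumSum lam (rowOf lam p + 1) := by
  obtain ⟨N, hN, rfl⟩ := h
  have hne : {r | p < cumSum lam (r + 1)}.Nonempty :=
    ⟨N, hp.trans_le (cumSum_mono lam (Nat.le_succ N))⟩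
  refine ⟨?_, Nat.sInf_mem hne⟩
  rcases hr : rowOf lam p with _ | r
  · simp [cumSum]
  · have : r ∉ {r | p < cumSum lam (r + 1)} := Nat.notMem_of_lt_sInf (by
      change r < rowOf lam p
      omega)
    simpa using this

theorem IsComposition.rowOf_eq_iff {n : ℕ} {lam : ℕ → ℕ} (h : IsComposition n lam) {p : ℕ}
    (hp : p < n) (i : ℕ) :
    rowOf lam p = i ↔ cumSum lam i ≤ p ∧ p < cumSum lam (i + 1) :=
  ⟨fun e => e ▸ h.rowOf_spec hp, fun e => rowOf_eq e.1 e.2⟩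

theorem IsComposition.monotone_rowOf {n : ℕ} {lam : ℕ → ℕ} (h : IsComposition n lam) :
    Monotone (fun p : Fin n => rowOf lam p) := by
  intro p p' hp
  exact Nat.sInf_le ((Fin.le_def.1 hp).trans_lt (h.rowOf_spec p'.2).2)

theorem IsComposition.map_filter_rowOf {n : ℕ} {lam : ℕ → ℕ} (h : IsComposition n lam) (i : ℕ) :
    (Finset.univ.filter (fun p : Fin n => rowOf lam p = i)).val.map
      (fun p : Fin n => (p : ℕ) - cumSum lam i) = Multiset.range (lam i) := by
  have hmem : ∀ p : Fin n, rowOf lam p = i ↔ cumSum lam i ≤ p ∧ (p : ℕ) < cumSum lam (i + 1) :=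
    fun p => h.rowOf_eq_iff p.2 i
  rw [← Finset.image_val_of_injOn]
  · rw [← Finset.range_val]
    congr 1
    ext x
    simp only [Finset.mem_image, Finset.mem_filter, Finset.mem_univ, true_and, hmem,
      Finset.mem_range, cumSum_succ]
    constructor
    · rintro ⟨p, hp, rfl⟩
      omega
    · intro hx
      have := h.cumSum_le (i + 1)
      rw [cumSum_succ] at this
      exact ⟨⟨cumSum lam i + x, by omega⟩, by simpa using hx, by simp⟩
  · intro p hp p' hp' e
    simp only [Finset.coe_filter, Finset.mem_univ, true_and, Set.mem_ofPred_eq, hmem] at hp hp'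
    simp only at e
    exact Fin.ext (by omega)

theorem IsComposition.card_filter_rowOf {n : ℕ} {lam : ℕ → ℕ} (h : IsComposition n lam) (i : ℕ) :
    (Finset.univ.filter (fun p : Fin n => rowOf lam p = i)).card = lam i := by
  have := congrArg Multiset.card (h.map_filter_rowOf i)
  rwa [Multiset.card_map, Finset.card_val, Multiset.card_range] at this

/-- The multiset of the values of `c` on the positions `a` such that `ρ (w a) = i`. -/
def rowContent {n : ℕ} (ρ c : Fin n → ℕ) (w : Equiv.Perm (Fin n)) (i : ℕ) : Multiset ℕ :=
  (Finset.univ.filter (fun a => ρ (w a) = i)).val.map c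

theorem card_filter_comp_perm {n : ℕ} (ρ : Fin n → ℕ) (w : Equiv.Perm (Fin n)) (i : ℕ) :
    (Finset.univ.filter (fun a => ρ (w a) = i)).card
      = (Finset.univ.filter (fun a => ρ a = i)).card := by
  refine Finset.card_bij' (fun a _ => w a) (fun a _ => w⁻¹ a) ?_ ?_ ?_ ?_ <;> simp

theorem card_rowContent {n : ℕ} (ρ c : Fin n → ℕ) (w : Equiv.Perm (Fin n)) (i : ℕ) :
    (rowContent ρ c w i).card = (Finset.univ.filter (fun a => ρ a = i)).card := by
  rw [rowContent, Multiset.card_map, Finset.card_val, card_filter_comp_perm]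

theorem sum_rowContent {n : ℕ} (ρ c : Fin n → ℕ) (w : Equiv.Perm (Fin n)) {N : ℕ}
    (hN : ∀ p, ρ p < N) :
    ∑ i ∈ Finset.range N, rowContent ρ c w i = (Finset.univ : Finset (Fin n)).val.map c := by
  have key : ∀ s : Finset (Fin n), s.val.map c = ∑ a ∈ s, ({c a} : Multiset ℕ) := by
    intro s
    rw [← Multiset.sum_map_singleton (s.val.map c), Multiset.map_map]
    rfl
  simp only [rowContent, key]
  exact Finset.sum_fiberwise_of_maps_to (fun a _ => Finset.mem_range.2 (hN (w a))) _

theorem exists_perm_of_card_fibers {n : ℕ} {α : Type*} [DecidableEq α] (f g : Fin n → α)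
    (h : ∀ x, (Finset.univ.filter (fun a => f a = x)).card
      = (Finset.univ.filter (fun a => g a = x)).card) :
    ∃ σ : Equiv.Perm (Fin n), ∀ a, g (σ a) = f a := by
  have e : ∀ x, Nonempty ({a // f a = x} ≃ {a // g a = x}) := fun x => by
    rw [← Fintype.card_eq, Fintype.card_subtype, Fintype.card_subtype, h]
  exact ⟨Equiv.ofFiberEquiv fun x => (e x).some, fun a => Equiv.ofFiberEquiv_map _ a⟩

theorem mem_doubleCoset_iff {n : ℕ} {lam mu : ℕ → ℕ} {d w : Equiv.Perm (Fin n)} :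
    w ∈ doubleCoset lam mu d ↔ ∀ i,
      rowContent (fun p => rowOf mu p) (fun p => rowOf lam p) w i
        = rowContent (fun p => rowOf mu p) (fun p => rowOf lam p) d i := by
  constructor
  · rintro ⟨x, hx, v, hv, rfl⟩ i
    have h1 : (Finset.univ.filter (fun a : Fin n => rowOf mu (d a : Fin n) = i))
        = (Finset.univ.filter (fun a : Fin n => rowOf mu ((v * d * x) a : Fin n) = i)).map
          x.toEmbedding := by
      ext b
      simp only [Finset.mem_filter, Finset.mem_univ, true_and, Finset.mem_map_equiv,
        Equiv.Perm.mul_apply, hv _, Equiv.apply_symm_apply]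
    simp only [rowContent]
    rw [h1, Finset.map_val, Multiset.map_map]
    exact Multiset.map_congr rfl fun a _ => (hx a).symm
  · intro h
    obtain ⟨σ, hσ⟩ := exists_perm_of_card_fibers
      (fun a : Fin n => (rowOf mu (w a : Fin n), rowOf lam (a : Fin n)))
      (fun a : Fin n => (rowOf mu (d a : Fin n), rowOf lam (a : Fin n))) (by
        rintro ⟨i, x⟩
        have hi := congrArg (Multiset.count x) (h i)
        rw [rowContent, rowContent, Multiset.count_map, Multiset.count_map] at hi
        simp only [Prod.mk.injEq, ← Finset.filter_filter, Finset.card_def]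
        simp only [eq_comm (a := x), ← Finset.filter_val] at hi
        exact hi)
    simp only [Prod.mk.injEq] at hσ
    refine ⟨σ, fun p => (hσ p).2, w * σ⁻¹ * d⁻¹, fun p => ?_, by group⟩
    have := (hσ (σ⁻¹ (d⁻¹ p))).1
    simp only [Equiv.Perm.coe_inv, Equiv.apply_symm_apply] at this
    simp only [Equiv.Perm.mul_apply, Equiv.Perm.coe_inv]
    exact this.symm

theorem map_entryAt_range (A : ℕ → Multiset ℕ) (i : ℕ) :
    (Multiset.range (A i).card).map (entryAt A i) = A i := by
  have hlen : ((A i).sort (· ≤ ·)).length = (A i).card := Multiset.length_sort _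
  conv_rhs => rw [← Multiset.sort_eq (A i) (· ≤ ·)]
  rw [← Multiset.coe_range, Multiset.map_coe]
  congr 1
  refine List.ext_getElem (by simp) fun k h1 h2 => ?_
  simp [entryAt, List.getElem?_eq_getElem h2]

theorem entryAt_mem {A : ℕ → Multiset ℕ} {i k : ℕ} (hk : k < (A i).card) :
    entryAt A i k ∈ A i := by
  have := Multiset.mem_map_of_mem (entryAt A i) (Multiset.mem_range.2 hk)
  rwa [map_entryAt_range] at this

theorem Is1A.rowContent_eq {n : ℕ} {mu lam : ℕ → ℕ} {A : ℕ → Multiset ℕ}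
    {d : Equiv.Perm (Fin n)} (hd : Is1A mu lam A d) (hmu : IsComposition n mu)
    (hA : RowsOfShape mu A) (i : ℕ) :
    rowContent (fun p => rowOf mu p) (fun p => rowOf lam p) d i = A i := by
  have h1 : (Finset.univ.filter (fun p : Fin n => rowOf mu p = i))
      = (Finset.univ.filter (fun a : Fin n => rowOf mu (d a : Fin n) = i)).map d.toEmbedding := by
    ext b
    simp only [Finset.mem_filter, Finset.mem_univ, true_and, Finset.mem_map_equiv,
      Equiv.apply_symm_apply]
  rw [← map_entryAt_range A i, hA i, ← hmu.map_filter_rowOf i, h1, Finset.map_val,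
    Multiset.map_map, Multiset.map_map, rowContent]
  refine Multiset.map_congr rfl fun a ha => ?_
  rw [Finset.mem_val, Finset.mem_filter] at ha
  have := hd.2 a
  rw [ha.2] at this
  exact this.symm

theorem Is1A.mem_doubleCoset_iff {n : ℕ} {mu lam : ℕ → ℕ} {A : ℕ → Multiset ℕ}
    {d : Equiv.Perm (Fin n)} (hd : Is1A mu lam A d) (hmu : IsComposition n mu)
    (hA : RowsOfShape mu A) {w : Equiv.Perm (Fin n)} :
    w ∈ doubleCoset lam mu d ↔
      ∀ i, rowContent (fun p => rowOf mu p) (fun p => rowOf lam p) w i = A i := by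
  rw [FayersSemistd.mem_doubleCoset_iff]
  simp only [hd.rowContent_eq hmu hA]

theorem Is1A.rowOf_mem {n : ℕ} {mu lam : ℕ → ℕ} {A : ℕ → Multiset ℕ}
    {d : Equiv.Perm (Fin n)} (hd : Is1A mu lam A d) (hmu : IsComposition n mu)
    (hA : RowsOfShape mu A) (p : Fin n) : rowOf lam p ∈ A (rowOf mu (d p : Fin n)) := by
  rw [← hd.2 p]
  have := hmu.rowOf_spec (d p).2
  rw [cumSum_succ] at this
  exact entryAt_mem (by rw [hA]; omega)

/-- If `W_λ ⊆ W_μ` and `d ∈ W_μ` then the double coset of `d` is `W_μ`. -/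
theorem doubleCoset_eq_youngW {n : ℕ} {lam mu : ℕ → ℕ} {d : Equiv.Perm (Fin n)}
    (hsub : youngW (n := n) lam ⊆ youngW mu) (hd : d ∈ youngW (n := n) mu) :
    doubleCoset lam mu d = youngW (n := n) mu := by
  ext w
  constructor
  · rintro ⟨x, hx, v, hv, rfl⟩ p
    rw [Equiv.Perm.mul_apply, Equiv.Perm.mul_apply, hv, hd, hsub hx]
  · intro hw
    refine ⟨1, fun p => rfl, w * d⁻¹, fun p => ?_, by simp⟩
    have := hd (d⁻¹ p)
    simp only [Equiv.Perm.coe_inv, Equiv.apply_symm_apply] at this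
    rw [Equiv.Perm.mul_apply, hw, Equiv.Perm.coe_inv, this]

/-! ### The coefficients of the composition -/

theorem blockInv_eq_invFinset_add {n : ℕ} {ν ρ : Fin n → ℕ} (hν : Monotone ν)
    (hρ : ∀ p, ρ p = if ν p ≤ 1 then 0 else 1) (hν3 : ∀ p, ν p ≤ 3)
    {g : Equiv.Perm (Fin n)} (hg : FiberMin ν g) :
    blockInv ρ g
      = invFinset (Finset.univ.filter (fun a => ν (g a) = 0))
          (Finset.univ.filter (fun a => ν (g a) = 1))
        + invFinset (Finset.univ.filter (fun a => ν (g a) = 2))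
          (Finset.univ.filter (fun a => ν (g a) = 3)) := by
  rw [invFinset, invFinset, blockInv, ← Finset.card_union_of_disjoint]
  · refine Finset.card_bij' (fun p _ => p.swap) (fun p _ => p.swap) ?_ ?_ ?_ ?_
    · rintro ⟨x, y⟩ h
      simp only [Finset.mem_filter, Finset.mem_univ, true_and, hρ] at h
      obtain ⟨hxy, hg', e⟩ := h
      have h1 := hν hg'.le
      have h2 : ν (g x) ≠ ν (g y) := fun e' => (hg x y hxy e').asymm hg'
      have := hν3 (g x)
      have := hν3 (g y)
      simp only [Prod.swap_prod_mk, Finset.mem_union, Finset.mem_filter, Finset.mem_product,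
        Finset.mem_univ, true_and, hxy, and_true]
      split_ifs at e <;> omega
    · rintro ⟨x, y⟩ h
      simp only [Finset.mem_union, Finset.mem_filter, Finset.mem_product,
        Finset.mem_univ, true_and] at h
      simp only [Prod.swap_prod_mk, Finset.mem_filter, Finset.mem_univ, true_and, hρ]
      refine ⟨by tauto, ?_, by rcases h with h | h <;> simp [h.1.1, h.1.2]⟩
      by_contra hlt
      have := hν (not_lt.1 hlt)
      omega
    · simp
    · simp
  · rw [Finset.disjoint_left]
    rintro ⟨x, y⟩ h h'
    simp only [Finset.mem_filter, Finset.mem_product, Finset.mem_univ, true_and] at h h'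
    omega

theorem exists_fiberMin {n : ℕ} {ν : Fin n → ℕ} (hν : Monotone ν) (hν3 : ∀ p, ν p ≤ 3)
    {P Q J K : Finset (Fin n)} (hPQ : ∀ a, a ∈ Q ↔ a ∉ P) (hJ : J ⊆ P) (hK : K ⊆ Q)
    (h0 : (Finset.univ.filter (fun p => ν p = 0)).card = J.card)
    (h1 : (Finset.univ.filter (fun p => ν p = 1)).card = (P \ J).card)
    (h2 : (Finset.univ.filter (fun p => ν p = 2)).card = K.card)
    (h3 : (Finset.univ.filter (fun p => ν p = 3)).card = (Q \ K).card) :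
    ∃ g : Equiv.Perm (Fin n), FiberMin ν g ∧
      Finset.univ.filter (fun a => ν (g a) = 0) = J ∧
      Finset.univ.filter (fun a => ν (g a) = 1) = P \ J ∧
      Finset.univ.filter (fun a => ν (g a) = 2) = K ∧
      Finset.univ.filter (fun a => ν (g a) = 3) = Q \ K := by
  let k : Fin n → ℕ := fun a =>
    if a ∈ P then (if a ∈ J then 0 else 1) else (if a ∈ K then 2 else 3)
  have k0 : Finset.univ.filter (fun a => k a = 0) = J := by
    ext a
    have := @hJ a
    simp only [k, Finset.mem_filter, Finset.mem_univ, true_and]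
    split_ifs <;> simp_all
  have k1 : Finset.univ.filter (fun a => k a = 1) = P \ J := by
    ext a
    simp only [k, Finset.mem_filter, Finset.mem_univ, true_and, Finset.mem_sdiff]
    split_ifs <;> simp_all
  have k2 : Finset.univ.filter (fun a => k a = 2) = K := by
    ext a
    have := @hK a
    have := hPQ a
    simp only [k, Finset.mem_filter, Finset.mem_univ, true_and]
    split_ifs <;> simp_all
  have k3 : Finset.univ.filter (fun a => k a = 3) = Q \ K := by
    ext a
    have := hPQ a
    simp only [k, Finset.mem_filter, Finset.mem_univ, true_and, Finset.mem_sdiff]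
    split_ifs <;> simp_all
  have hk3 : ∀ a, k a ≤ 3 := by
    intro a
    simp only [k]
    split_ifs <;> omega
  obtain ⟨σ, hσ⟩ := exists_perm_of_card_fibers k ν fun x => by
    rcases (by omega : x = 0 ∨ x = 1 ∨ x = 2 ∨ x = 3 ∨ 3 < x) with rfl | rfl | rfl | rfl | hx
    · rw [k0, h0]
    · rw [k1, h1]
    · rw [k2, h2]
    · rw [k3, h3]
    · rw [Finset.filter_false_of_mem fun a _ => ((hk3 a).trans_lt hx).ne,
        Finset.filter_false_of_mem fun a _ => ((hν3 a).trans_lt hx).ne]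
  have hg : ∀ a, ν (minRep ν σ a) = k a := fun a => (comp_minRep hν σ a).trans (hσ a)
  refine ⟨minRep ν σ, fiberMin_minRep hν σ, ?_⟩
  simp only [hg]
  exact ⟨k0, k1, k2, k3⟩

theorem sum_pow_blockInv {F : Type*} [Field F] (q : F) {n : ℕ} {c ν ρ κ : Fin n → ℕ}
    (hc : Monotone c) (hν : Monotone ν) (hν3 : ∀ p, ν p ≤ 3)
    (hρ : ∀ p, ρ p = if ν p ≤ 1 then 0 else 1)
    (hκ : ∀ p, κ p = if ν p = 0 then 0 else if ν p ≤ 2 then 1 else 2)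
    (w : Equiv.Perm (Fin n)) {R U V W : Multiset ℕ}
    (h0 : rowContent ρ c w 0 = R + U) (h1 : rowContent ρ c w 1 = V + W)
    (hR : (Finset.univ.filter (fun p => ν p = 0)).card = R.card)
    (hU : (Finset.univ.filter (fun p => ν p = 1)).card = U.card)
    (hV : (Finset.univ.filter (fun p => ν p = 2)).card = V.card)
    (hW : (Finset.univ.filter (fun p => ν p = 3)).card = W.card) :
    ∑ g ∈ Finset.univ.filter (fun g : Equiv.Perm (Fin n) => FiberMin ν g ∧
        (∀ a, ρ (g a) = ρ (w a)) ∧ rowContent κ c g 0 = R ∧ rowContent κ c g 2 = W),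
      q ^ blockInv ρ g
      = qBinomProd q R U * qBinomProd q W V * q ^ (invPairs R U + invPairs V W) := by
  set P := Finset.univ.filter (fun a => ρ (w a) = 0) with hP
  set Q := Finset.univ.filter (fun a => ρ (w a) = 1) with hQ
  have hρν : ∀ (g : Equiv.Perm (Fin n)), (∀ a, ρ (g a) = ρ (w a)) → ∀ a,
      (a ∈ P ↔ ν (g a) ≤ 1) ∧ (a ∈ Q ↔ 2 ≤ ν (g a)) := by
    intro g hg a
    simp only [hP, hQ, Finset.mem_filter, Finset.mem_univ, true_and, ← hg, hρ]
    split_ifs <;> simp <;> omega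
  have hP1 : ∀ (g : Equiv.Perm (Fin n)), (∀ a, ρ (g a) = ρ (w a)) →
      P \ Finset.univ.filter (fun a => ν (g a) = 0)
        = Finset.univ.filter (fun a => ν (g a) = 1) := by
    intro g hg
    ext a
    simp only [Finset.mem_sdiff, (hρν g hg a).1, Finset.mem_filter, Finset.mem_univ, true_and]
    omega
  have hQ1 : ∀ (g : Equiv.Perm (Fin n)), (∀ a, ρ (g a) = ρ (w a)) →
      Q \ Finset.univ.filter (fun a => ν (g a) = 2)
        = Finset.univ.filter (fun a => ν (g a) = 3) := by
    intro g hg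
    ext a
    have := hν3 (g a)
    simp only [Finset.mem_sdiff, (hρν g hg a).2, Finset.mem_filter, Finset.mem_univ, true_and]
    omega
  have hκ0 : ∀ g : Equiv.Perm (Fin n), rowContent κ c g 0
      = (Finset.univ.filter (fun a => ν (g a) = 0)).val.map c := by
    intro g
    rw [rowContent]
    congr 3
    ext a
    rw [hκ]
    split_ifs <;> simp_all
  have hκ2 : ∀ g : Equiv.Perm (Fin n), rowContent κ c g 2
      = (Finset.univ.filter (fun a => ν (g a) = 3)).val.map c := by
    intro g
    rw [rowContent]
    congr 3
    ext a
    rw [hκ]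
    have := hν3 (g a)
    split_ifs <;> simp <;> omega
  have hsplit : ∀ {J K : Finset (Fin n)}, J ⊆ K →
      K.val.map c = J.val.map c + (K \ J).val.map c := by
    intro J K hJ
    rw [← Multiset.map_add, Finset.sdiff_val, add_tsub_cancel_of_le (Finset.val_le_iff.2 hJ)]
  rw [pow_add, qBinomProd_symm q W V, mul_mul_mul_comm, ← sum_powerset_pow_invFinset q hc P R U h0,
    ← sum_powerset_pow_invFinset q hc Q V W h1, Finset.sum_mul_sum, ← Finset.sum_product']
  refine Finset.sum_bij (fun g _ => (Finset.univ.filter (fun a => ν (g a) = 0),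
    Finset.univ.filter (fun a => ν (g a) = 2))) ?_ ?_ ?_ ?_
  · intro g hg
    obtain ⟨hmin, hgw, hg0, hg2⟩ := (Finset.mem_filter.1 hg).2
    have hJ' : Finset.univ.filter (fun a => ν (g a) = 2) ⊆ Q := fun a ha => by
      rw [(hρν g hgw a).2, (Finset.mem_filter.1 ha).2]
    rw [Finset.mem_product, Finset.mem_filter, Finset.mem_filter, Finset.mem_powerset,
      Finset.mem_powerset]
    refine ⟨⟨fun a ha => ?_, ?_⟩, hJ', ?_⟩
    · rw [(hρν g hgw a).1, (Finset.mem_filter.1 ha).2]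
      exact Nat.zero_le 1
    · exact (hκ0 g).symm.trans hg0
    · have h := hsplit hJ'
      rw [hQ1 g hgw, ← hκ2 g, hg2] at h
      exact add_right_cancel (h.symm.trans h1)
  · intro g hg g' hg' e
    obtain ⟨hmin, hgw, -, -⟩ := (Finset.mem_filter.1 hg).2
    obtain ⟨hmin', hgw', -, -⟩ := (Finset.mem_filter.1 hg').2
    have e0 := Finset.ext_iff.1 (Prod.ext_iff.1 e).1
    have e2 := Finset.ext_iff.1 (Prod.ext_iff.1 e).2
    simp only [Finset.mem_filter, Finset.mem_univ, true_and] at e0 e2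
    refine (eq_minRep hν hmin (w := g') fun a => ?_).trans (eq_minRep hν hmin' fun a => rfl).symm
    have := (hρν g hgw a).1.symm.trans (hρν g' hgw' a).1
    have := e0 a
    have := e2 a
    have := hν3 (g a)
    have := hν3 (g' a)
    omega
  · rintro ⟨J, J'⟩ hJ
    rw [Finset.mem_product, Finset.mem_filter, Finset.mem_filter, Finset.mem_powerset,
      Finset.mem_powerset] at hJ
    obtain ⟨⟨hJP, hJR⟩, hJQ, hJV⟩ := hJ
    simp only at hJP hJR hJQ hJV
    have hJU : (P \ J).val.map c = U := by
      have h := hsplit hJP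
      rw [hJR] at h
      exact (add_left_cancel (h0.symm.trans h)).symm
    have hJW : (Q \ J').val.map c = W := by
      have h := hsplit hJQ
      rw [hJV] at h
      exact (add_left_cancel (h1.symm.trans h)).symm
    have hPQ : ∀ a, a ∈ Q ↔ a ∉ P := by
      intro a
      have := hρν w (fun a => rfl) a
      rw [this.1, this.2]
      omega
    have hcard : ∀ K : Finset (Fin n), K.card = (K.val.map c).card := fun K => by
      rw [Multiset.card_map, Finset.card_val]
    obtain ⟨g, hmin, e0, e1, e2, e3⟩ := exists_fiberMin hν hν3 hPQ hJP hJQ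
      (by rw [hR, hcard, hJR]) (by rw [hU, hcard, hJU]) (by rw [hV, hcard, hJV])
      (by rw [hW, hcard, hJW])
    have hgw : ∀ a, ρ (g a) = ρ (w a) := by
      intro a
      have hw := (hρν w (fun a => rfl) a).1
      have := hν3 (g a)
      have h0 : ν (g a) = 0 → a ∈ P := fun h => hJP (by rw [← e0]; simpa using h)
      have h1 : ν (g a) = 1 → a ∈ P := fun h =>
        (Finset.mem_sdiff.1 (by rw [← e1]; simpa using h : a ∈ P \ J)).1
      have h2 : ν (g a) = 2 → a ∈ Q := fun h => hJQ (by rw [← e2]; simpa using h)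
      have h3 : ν (g a) = 3 → a ∈ Q := fun h =>
        (Finset.mem_sdiff.1 (by rw [← e3]; simpa using h : a ∈ Q \ J')).1
      rw [hPQ] at h2 h3
      rw [hρ, hρ]
      refine if_congr ?_ rfl rfl
      rw [← hw]
      constructor
      · intro h
        rcases (by omega : ν (g a) = 0 ∨ ν (g a) = 1) with h | h
        exacts [h0 h, h1 h]
      · intro h
        by_contra hlt
        rcases (by omega : ν (g a) = 2 ∨ ν (g a) = 3) with h' | h'
        exacts [h2 h' h, h3 h' h]
    refine ⟨g, ?_, by rw [e0, e2]⟩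
    rw [Finset.mem_filter, hκ0, hκ2, e0, e3]
    exact ⟨Finset.mem_univ _, hmin, hgw, hJR, hJW⟩
  · intro g hg
    obtain ⟨hmin, hgw, -, -⟩ := (Finset.mem_filter.1 hg).2
    rw [← pow_add, hP1 g hgw, hQ1 g hgw, blockInv_eq_invFinset_add hν hρ hν3 hmin]

theorem rowContent_eq_add {n : ℕ} {ν ρ c : Fin n → ℕ} {g : Equiv.Perm (Fin n)} {i j k : ℕ}
    (hjk : j ≠ k) (h : ∀ p, ρ p = i ↔ ν p = j ∨ ν p = k) :
    rowContent ρ c g i = rowContent ν c g j + rowContent ν c g k := by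
  rw [rowContent, rowContent, rowContent, ← Multiset.map_add]
  congr 1
  have hd : Disjoint (Finset.univ.filter (fun a => ν (g a) = j))
      (Finset.univ.filter (fun a => ν (g a) = k)) := by
    rw [Finset.disjoint_left]
    intro a h1 h2
    rw [Finset.mem_filter] at h1 h2
    exact hjk (h1.2.symm.trans h2.2)
  rw [← Finset.disjUnion_val _ _ hd]
  congr 1
  ext a
  simp [h]

theorem sum_fiberPerms_mul {M : Type*} [AddCommMonoid M] {n : ℕ} (ρ : Fin n → ℕ)
    (f : Equiv.Perm (Fin n) → M) (g : Equiv.Perm (Fin n)) :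
    ∑ v ∈ fiberPerms ρ, f (v * g)
      = ∑ w ∈ Finset.univ.filter (fun w : Equiv.Perm (Fin n) => ∀ a, ρ (g a) = ρ (w a)), f w := by
  refine Finset.sum_bij' (fun v _ => v * g) (fun w _ => w * g⁻¹) ?_ ?_ ?_ ?_ ?_
  · intro v hv
    rw [mem_fiberPerms] at hv
    simp [hv]
  · intro w hw
    rw [Finset.mem_filter] at hw
    rw [mem_fiberPerms]
    intro p
    have := hw.2 (g⁻¹ p)
    rw [Equiv.Perm.coe_inv, Equiv.apply_symm_apply] at this
    exact this.symm
  · simp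
  · simp
  · simp

theorem sum_smul_sum_filter {F H ι α : Type*} [Semiring F] [AddCommMonoid H] [Module F H]
    [Fintype α] (s : Finset ι) (a : ι → F) (p : ι → α → Prop)
    [∀ i w, Decidable (p i w)] (f : α → H) :
    ∑ i ∈ s, a i • ∑ w ∈ Finset.univ.filter (p i), f w
      = ∑ w, (∑ i ∈ s.filter (fun i => p i w), a i) • f w := by
  simp only [Finset.smul_sum, Finset.sum_smul]
  refine Finset.sum_comm' fun i w => ?_
  simp

section
variable {F : Type*} [Field F] {H : Type*} [Ring H] [Algebra F H] {n : ℕ}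

theorem IsHeckeBasis.sum_mul_fiberSum {q : F} {T : Equiv.Perm (Fin n) → H}
    (hT : IsHeckeBasis q T) {c ν ρ κ : Fin n → ℕ} {R S W : Multiset ℕ} {m : ℕ}
    (hc : Monotone c) (hν : Monotone ν) (hρm : Monotone ρ) (hν3 : ∀ p, ν p ≤ 3)
    (hρ : ∀ p, ρ p = if ν p ≤ 1 then 0 else 1)
    (hκ : ∀ p, κ p = if ν p = 0 then 0 else if ν p ≤ 2 then 1 else 2)
    (hX : (Finset.univ : Finset (Fin n)).val.map c = R + S + W)
    (h0 : (Finset.univ.filter (fun p => ν p = 0)).card = R.card)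
    (h1 : (Finset.univ.filter (fun p => ν p = 1)).card + R.card = m)
    (h2 : (Finset.univ.filter (fun p => ν p = 1)).card
      + (Finset.univ.filter (fun p => ν p = 2)).card = S.card)
    (h3 : (Finset.univ.filter (fun p => ν p = 3)).card = W.card) :
    (∑ g ∈ Finset.univ.filter (fun g : Equiv.Perm (Fin n) =>
        FiberMin ν g ∧ rowContent κ c g 0 = R ∧ rowContent κ c g 2 = W), T g) * fiberSum T ρ
      = ∑ U ∈ S.powerset.toFinset.filter (fun U => U.card + R.card = m),
          (qBinomProd q R U * qBinomProd q W (S - U) *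
            q ^ (invPairs R U + invPairs (S - U) W)) •
          ∑ w ∈ Finset.univ.filter (fun w : Equiv.Perm (Fin n) =>
            rowContent ρ c w 0 = R + U ∧ rowContent ρ c w 1 = W + (S - U)), T w := by
  rw [Finset.sum_mul, Finset.sum_congr rfl fun g _ => (hT.mul_fiberSum hρm g).trans
    (congrArg _ (sum_fiberPerms_mul ρ T g)), sum_smul_sum_filter, sum_smul_sum_filter]
  refine Finset.sum_congr rfl fun w _ => congrArg (· • T w) ?_
  by_cases hex : ∃ U, U ≤ S ∧ U.card + R.card = m ∧
      rowContent ρ c w 0 = R + U ∧ rowContent ρ c w 1 = W + (S - U)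
  · obtain ⟨U, hUS, hUm, hU0, hU1⟩ := hex
    have hcardS : (S - U).card = S.card - U.card := Multiset.card_sub hUS
    have hfilter : (S.powerset.toFinset.filter (fun U => U.card + R.card = m)).filter
        (fun U => rowContent ρ c w 0 = R + U ∧ rowContent ρ c w 1 = W + (S - U)) = {U} := by
      ext U'
      simp only [Finset.mem_filter, Multiset.mem_toFinset, Multiset.mem_powerset,
        Finset.mem_singleton]
      constructor
      · rintro ⟨-, h, -⟩
        exact add_left_cancel (h.symm.trans hU0)
      · rintro rfl
        exact ⟨⟨hUS, hUm⟩, hU0, hU1⟩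
    rw [hfilter, Finset.sum_singleton, ← sum_pow_blockInv q hc hν hν3 hρ hκ w hU0
      (hU1.trans (add_comm _ _)) h0 (by omega) (by omega) h3]
    refine Finset.sum_congr ?_ fun _ _ => rfl
    ext g
    simp only [Finset.mem_filter, Finset.mem_univ, true_and]
    tauto
  · rw [Finset.filter_false_of_mem, Finset.filter_false_of_mem]
    · simp
    · intro U hU hw
      simp only [Finset.mem_filter, Multiset.mem_toFinset, Multiset.mem_powerset] at hU
      exact hex ⟨U, hU.1, hU.2, hw⟩
    · intro g hg hgw
      obtain ⟨-, hg0, hg2⟩ := (Finset.mem_filter.1 hg).2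
      have e0 : rowContent ρ c g 0 = rowContent ν c g 0 + rowContent ν c g 1 :=
        rowContent_eq_add zero_ne_one fun p => by
          rw [hρ]
          split_ifs <;> simp <;> omega
      have e1 : rowContent ρ c g 1 = rowContent ν c g 2 + rowContent ν c g 3 :=
        rowContent_eq_add (by omega) fun p => by
          have := hν3 p
          rw [hρ]
          split_ifs <;> simp <;> omega
      have ek0 : rowContent κ c g 0 = rowContent ν c g 0 := by
        simp only [rowContent]
        congr 3
        ext a
        rw [hκ]
        split_ifs <;> simp_all
      have ek2 : rowContent κ c g 2 = rowContent ν c g 3 := by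
        simp only [rowContent]
        congr 3
        ext a
        have := hν3 (g a)
        rw [hκ]
        split_ifs <;> simp <;> omega
      have hgw' : ∀ i, rowContent ρ c g i = rowContent ρ c w i := fun i => by
        simp only [rowContent, hgw]
      have htot := sum_rowContent ρ c g (N := 2) fun p => by
        rw [hρ]
        split_ifs <;> omega
      rw [Finset.sum_range_succ, Finset.sum_range_one, e0, e1, hX, ← ek0, ← ek2, hg0, hg2] at htot
      have hS : rowContent ν c g 1 + rowContent ν c g 2 = S := by
        refine add_left_cancel (a := R) (add_right_cancel (b := W) ?_)
        rw [← htot]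
        abel
      refine hex ⟨rowContent ν c g 1, hS ▸ Multiset.le_add_right _ _, ?_, ?_, ?_⟩
      · rw [card_rowContent, h1]
      · rw [← hgw', e0, ← ek0, hg0]
      · rw [← hgw', e1, ← ek2, hg2, ← hS, add_tsub_cancel_left, add_comm]

theorem xElt_eq_fiberSum (T : Equiv.Perm (Fin n) → H) (lam : ℕ → ℕ) :
    xElt T lam = fiberSum T (fun p => rowOf lam p) := by
  rw [xElt, fiberSum]
  congr 1
  ext w
  rw [Finset.mem_filter, mem_fiberPerms]
  exact ⟨fun h => h.2, fun h => ⟨Finset.mem_univ _, h⟩⟩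

end

theorem isComposition_of_count {lam : ℕ → ℕ} (X : Multiset ℕ) (h : ∀ x, lam x = X.count x) :
    IsComposition X.card lam := by
  refine ⟨X.toFinset.sup id + 1, fun r hr => ?_, ?_⟩
  · rw [h, Multiset.count_eq_zero]
    intro hx
    have := Finset.le_sup (f := id) (Multiset.mem_toFinset.2 hx)
    simp only [id] at this
    omega
  · simp only [cumSum, h]
    refine Multiset.sum_count_eq_card fun a ha => ?_
    have := Finset.le_sup (f := id) (Multiset.mem_toFinset.2 ha)
    simp only [id] at this
    rw [Finset.mem_range]
    omega

theorem isComposition_comp2 (a b : ℕ) : IsComposition (a + b) (comp2 a b) :=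
  ⟨2, fun r hr => by
    simp only [comp2]
    split_ifs <;> omega, by simp [cumSum, comp2, Finset.sum_range_succ]⟩

theorem isComposition_comp3 (a b c : ℕ) : IsComposition (a + b + c) (comp3 a b c) :=
  ⟨3, fun r hr => by
    simp only [comp3]
    split_ifs <;> omega, by simp [cumSum, comp3, Finset.sum_range_succ]⟩

theorem isComposition_comp4 (a b c d : ℕ) : IsComposition (a + b + c + d) (comp4 a b c d) :=
  ⟨4, fun r hr => by
    simp only [comp4]
    split_ifs <;> omega, by simp [cumSum, comp4, Finset.sum_range_succ]⟩

theorem rowOf_comp2 {a b p : ℕ} (hp : p < a + b) :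
    rowOf (comp2 a b) p = if p < a then 0 else 1 := by
  split_ifs with h <;> refine rowOf_eq ?_ ?_ <;>
    simp [cumSum, comp2, Finset.sum_range_succ] <;> omega

theorem rowOf_comp3 {a b c p : ℕ} (hp : p < a + b + c) :
    rowOf (comp3 a b c) p = if p < a then 0 else if p < a + b then 1 else 2 := by
  split_ifs with h <;> refine rowOf_eq ?_ ?_ <;>
    simp [cumSum, comp3, Finset.sum_range_succ] <;> omega

theorem rowOf_comp4 {a b c d p : ℕ} (hp : p < a + b + c + d) :
    rowOf (comp4 a b c d) p
      = if p < a then 0 else if p < a + b then 1 else if p < a + b + c then 2 else 3 := by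
  split_ifs with h <;> refine rowOf_eq ?_ ?_ <;>
    simp [cumSum, comp4, Finset.sum_range_succ] <;> omega

/-- If `W_μ ⊆ W_λ` and `d ∈ W_λ` then the double coset of `d` is `W_λ`. -/
theorem doubleCoset_eq_youngW_left {n : ℕ} {lam mu : ℕ → ℕ} {d : Equiv.Perm (Fin n)}
    (hsub : youngW (n := n) mu ⊆ youngW lam) (hd : d ∈ youngW (n := n) lam) :
    doubleCoset lam mu d = youngW (n := n) lam := by
  ext w
  constructor
  · rintro ⟨x, hx, v, hv, rfl⟩ p
    rw [Equiv.Perm.mul_apply, Equiv.Perm.mul_apply, hsub hv, hd, hx]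
  · intro hw
    refine ⟨d⁻¹ * w, fun p => ?_, 1, fun p => rfl, by simp⟩
    have := hd ((d⁻¹ * w) p)
    simp only [Equiv.Perm.mul_apply, Equiv.Perm.coe_inv, Equiv.apply_symm_apply] at this ⊢
    rw [← this, hw]

/-- Proposition: the Garnir homomorphism as a composition.
With `μ = (m,n-m) ⊢ n`, multisets `R,S,T` as in the two-row Garnir relation,
`r = |R|`, `s = |S|`, `t = |T|`, `u = m-r`, `v = n-m-t`; `E` the row-standard
`(r,s,t)`-tableau with rows `(R,S,T)`; `B` the row-standard `(r+u,v+t)`-tableau with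
`r` entries `0`, `u` entries `1` / `v` entries `2`, `t` entries `3`; `D` the
`(r,u,v,t)`-tableau with constant rows `0,1,1,2`.  Then
`φ_B φ_D φ_E = ∑_{(U,V)∈𝒮} (∏_i [R_i+U_i, R_i][T_i+V_i, T_i]) (∏_{i<j} q^{R_j U_i + T_i V_j}) φ_{A[U,V]}`
as homomorphisms `M^μ → M^λ` (left factors applied first). -/
theorem garnir_composition
    {F : Type*} [Field F] {H : Type*} [Ring H] [Algebra F H]
    {n m : ℕ} (hn : 1 ≤ n) (hmn : m ≤ n) (hmm : n - m ≤ m)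
    (q : F) (hq : q ≠ 0)
    (T : Equiv.Perm (Fin n) → H) (hT : IsHeckeBasis q T)
    (R S Tt : Multiset ℕ)
    (hcard : R.card + S.card + Tt.card = n) (hR : R.card ≤ m) (hS : m < S.card)
    (r s t u v : ℕ)
    (hr : r = R.card) (hs : s = S.card) (ht : t = Tt.card)
    (hu : u = m - r) (hv : v = n - m - t)
    (mu : ℕ → ℕ) (hmu : mu = comp2 m (n - m))
    (hmu' : mu = comp2 (r + u) (v + t))
    (lam : ℕ → ℕ) (hlam : ∀ x, lam x = R.count x + S.count x + Tt.count x)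
    (dB : Equiv.Perm (Fin n))
    (hdB : Is1A mu (comp4 r u v t)
      (rows2 (Multiset.replicate r 0 + Multiset.replicate u 1)
             (Multiset.replicate v 2 + Multiset.replicate t 3)) dB)
    (dD : Equiv.Perm (Fin n))
    (hdD : Is1A (comp4 r u v t) (comp3 r s t)
      (rows4 (Multiset.replicate r 0) (Multiset.replicate u 1)
             (Multiset.replicate v 1) (Multiset.replicate t 2)) dD)
    (dE : Equiv.Perm (Fin n))
    (hdE : Is1A (comp3 r s t) lam (rows3 R S Tt) dE)
    (dA : Multiset ℕ → Equiv.Perm (Fin n))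
    (hdA : ∀ U ∈ S.powerset.toFinset.filter (fun U => U.card + R.card = m),
      Is1A mu lam (rows2 (R + U) (Tt + (S - U))) (dA U))
    (Mmu : Submodule Hᵐᵒᵖ H) (hMmu : Mmu = Submodule.span Hᵐᵒᵖ {xElt T mu})
    (M4 : Submodule Hᵐᵒᵖ H) (hM4 : M4 = Submodule.span Hᵐᵒᵖ {xElt T (comp4 r u v t)})
    (M3 : Submodule Hᵐᵒᵖ H) (hM3 : M3 = Submodule.span Hᵐᵒᵖ {xElt T (comp3 r s t)})
    (hxmu : xElt T mu ∈ Mmu) (hx4 : xElt T (comp4 r u v t) ∈ M4)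
    (hx3 : xElt T (comp3 r s t) ∈ M3)
    (φB : Mmu →ₗ[Hᵐᵒᵖ] H)
    (hφB : φB ⟨xElt T mu, hxmu⟩ = XPhi T (comp4 r u v t) mu dB)
    (hrB : ∀ z : Mmu, φB z ∈ M4)
    (φD : M4 →ₗ[Hᵐᵒᵖ] H)
    (hφD : φD ⟨xElt T (comp4 r u v t), hx4⟩
      = XPhi T (comp3 r s t) (comp4 r u v t) dD)
    (hrD : ∀ z : M4, φD z ∈ M3)
    (φE : M3 →ₗ[Hᵐᵒᵖ] H)
    (hφE : φE ⟨xElt T (comp3 r s t), hx3⟩ = XPhi T lam (comp3 r s t) dE)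
    (φA : Multiset ℕ → (Mmu →ₗ[Hᵐᵒᵖ] H))
    (hφA : ∀ U ∈ S.powerset.toFinset.filter (fun U => U.card + R.card = m),
      φA U ⟨xElt T mu, hxmu⟩ = XPhi T lam mu (dA U)) :
    ∀ z : Mmu, φE ⟨φD ⟨φB z, hrB z⟩, hrD _⟩
      = ∑ U ∈ S.powerset.toFinset.filter (fun U => U.card + R.card = m),
          (qBinomProd q R U * qBinomProd q Tt (S - U) *
            q ^ (invPairs R U + invPairs (S - U) Tt)) • (φA U z) := by
  obtain ⟨hru, hvt, huv, hrst⟩ : r + u = m ∧ v + t = n - m ∧ u + v = s ∧ r + s + t = n := by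
    omega
  have hcmu : IsComposition n mu := by
    have := isComposition_comp2 m (n - m)
    rwa [← hmu, Nat.add_sub_cancel' hmn] at this
  have hc4 : IsComposition n (comp4 r u v t) := by
    have := isComposition_comp4 r u v t
    rwa [(by omega : r + u + v + t = n)] at this
  have hc3 : IsComposition n (comp3 r s t) := by
    have := isComposition_comp3 r s t
    rwa [hrst] at this
  have hcl : IsComposition n lam := by
    have := isComposition_of_count (lam := lam) (R + S + Tt) fun x => by
      rw [hlam, Multiset.count_add, Multiset.count_add]
    rwa [Multiset.card_add, Multiset.card_add, hcard] at this
  have hsmu : ∀ A B : Multiset ℕ, A.card = m → B.card = n - m → RowsOfShape mu (rows2 A B) := by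
    intro A B hA hB i
    rw [hmu, rows2, comp2]
    split_ifs <;> simp [hA, hB]
  have hs4 : RowsOfShape (comp4 r u v t) (rows4 (Multiset.replicate r 0)
      (Multiset.replicate u 1) (Multiset.replicate v 1) (Multiset.replicate t 2)) := by
    intro i
    rw [rows4, comp4]
    split_ifs <;> simp
  have hs3 : RowsOfShape (comp3 r s t) (rows3 R S Tt) := by
    intro i
    rw [rows3, comp3]
    split_ifs <;> simp [hr, hs, ht]
  set c : Fin n → ℕ := fun p => rowOf lam p with hc
  set ν : Fin n → ℕ := fun p => rowOf (comp4 r u v t) p with hν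
  set ρ : Fin n → ℕ := fun p => rowOf mu p with hρ
  set κ : Fin n → ℕ := fun p => rowOf (comp3 r s t) p with hκ
  have hνp : ∀ p : Fin n, ν p = if (p : ℕ) < r then 0 else if (p : ℕ) < r + u then 1
      else if (p : ℕ) < r + u + v then 2 else 3 := fun p => rowOf_comp4 (by omega)
  have hρp : ∀ p : Fin n, ρ p = if (p : ℕ) < m then 0 else 1 := fun p => by
    simp only [hρ, hmu]
    exact rowOf_comp2 (by omega)
  have hκp : ∀ p : Fin n, κ p = if (p : ℕ) < r then 0 else if (p : ℕ) < r + s then 1 else 2 :=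
    fun p => rowOf_comp3 (by omega)
  have hν3 : ∀ p, ν p ≤ 3 := fun p => by
    rw [hνp]
    split_ifs <;> omega
  have hρν : ∀ p, ρ p = if ν p ≤ 1 then 0 else 1 := fun p => by
    rw [hρp, hνp]
    split_ifs <;> omega
  have hκν : ∀ p, κ p = if ν p = 0 then 0 else if ν p ≤ 2 then 1 else 2 := fun p => by
    rw [hκp, hνp]
    split_ifs <;> omega
  have hsub : youngW (n := n) (comp4 r u v t) ⊆ youngW mu := fun w hw p => by
    have h : ν (w p) = ν p := hw p
    change ρ (w p) = ρ p
    rw [hρν, hρν, h]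
  have hsub' : youngW (n := n) (comp4 r u v t) ⊆ youngW (comp3 r s t) := fun w hw p => by
    have h : ν (w p) = ν p := hw p
    change κ (w p) = κ p
    rw [hκν, hκν, h]
  have hdBmem : dB ∈ youngW (n := n) mu := fun p => by
    have h : ν p ∈ rows2 _ _ (ρ (dB p)) := hdB.rowOf_mem hcmu (hsmu _ _ (by simpa using hru)
      (by simpa using hvt)) p
    change ρ (dB p) = ρ p
    rw [hρν p]
    rw [hρp] at h ⊢
    split_ifs at h ⊢ <;> simp [rows2, Multiset.mem_replicate] at h <;> omega
  have hdDmem : dD ∈ youngW (n := n) (comp3 r s t) := fun p => by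
    have h : κ p ∈ rows4 _ _ _ _ (ν (dD p)) := hdD.rowOf_mem hc4 hs4 p
    change κ (dD p) = κ p
    rw [hκν (dD p)]
    have := hν3 (dD p)
    obtain h' | h' | h' | h' :
      ν (dD p) = 0 ∨ ν (dD p) = 1 ∨ ν (dD p) = 2 ∨ ν (dD p) = 3 := by omega
    all_goals
      rw [h'] at h ⊢
      simp [rows4, Multiset.mem_replicate] at h
      simp [h.2]
  have hBx : φB ⟨xElt T mu, hxmu⟩ = xElt T mu := by
    rw [hφB, XPhi, xElt, doubleCoset_eq_youngW hsub hdBmem]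
  have hDx : φD ⟨xElt T (comp4 r u v t), hx4⟩ = xElt T (comp3 r s t) := by
    rw [hφD, XPhi, xElt, doubleCoset_eq_youngW_left hsub' hdDmem]
  obtain ⟨h, hh⟩ : ∃ h : Hᵐᵒᵖ, h • xElt T (comp4 r u v t) = xElt T mu := by
    have := hrB ⟨xElt T mu, hxmu⟩
    rwa [hBx, hM4, Submodule.mem_span_singleton] at this
  set Z : H := ∑ g ∈ Finset.univ.filter (fun g : Equiv.Perm (Fin n) =>
    FiberMin ν g ∧ rowContent κ c g 0 = R ∧ rowContent κ c g 2 = Tt), T g with hZ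
  have hX : (Finset.univ : Finset (Fin n)).val.map c = R + S + Tt := by
    rw [← sum_rowContent κ c dE (N := 3) fun p => by
      rw [hκν]
      split_ifs <;> omega]
    simp only [hκ, hc, hdE.rowContent_eq hc3 hs3]
    simp [Finset.sum_range_succ, rows3]
  have hEx : φE ⟨xElt T (comp3 r s t), hx3⟩ = Z * xElt T (comp4 r u v t) := by
    have hmem : ∀ w, w ∈ doubleCoset lam (comp3 r s t) dE ↔
        rowContent κ c w 0 = R ∧ rowContent κ c w 2 = Tt := by
      intro w
      rw [hdE.mem_doubleCoset_iff hc3 hs3]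
      refine ⟨fun hw => ⟨hw 0, hw 2⟩, fun ⟨hw0, hw2⟩ i => ?_⟩
      have htot := sum_rowContent κ c w (N := 3) fun p => by
        rw [hκν]
        split_ifs <;> omega
      rw [Finset.sum_range_succ, Finset.sum_range_succ, Finset.sum_range_one, hX, hw0, hw2] at htot
      have hw1 := add_left_cancel (add_right_cancel htot)
      rcases (by omega : i = 0 ∨ i = 1 ∨ i = 2 ∨ 2 < i) with rfl | rfl | rfl | hi
      · exact hw0
      · exact hw1
      · exact hw2
      · have h0 := card_rowContent κ c w i
        rw [hc3.card_filter_rowOf] at h0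
        rw [show comp3 r s t i = 0 by simp only [comp3]; split_ifs <;> omega,
          Multiset.card_eq_zero] at h0
        rw [h0]
        simp only [rows3]
        split_ifs <;> first | rfl | omega
    rw [hφE, XPhi, xElt_eq_fiberSum, hT.sum_eq_mul_fiberSum hc4.monotone_rowOf]
    · congr 1
      rw [hZ]
      refine Finset.sum_congr ?_ fun _ _ => rfl
      ext g
      simp only [Finset.mem_filter, Finset.mem_univ, true_and, hmem]
      tauto
    · intro y hy w hw
      rw [mem_fiberPerms] at hy
      rw [Finset.mem_filter] at hw ⊢
      refine ⟨Finset.mem_univ _, ?_⟩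
      obtain ⟨a, ha, b, hb, rfl⟩ := hw.2
      refine ⟨a, ha, y * b, fun p => ?_, by simp only [mul_assoc]⟩
      rw [Equiv.Perm.mul_apply, hsub' hy, hb]
  have hmain : Z * xElt T mu = ∑ U ∈ S.powerset.toFinset.filter (fun U => U.card + R.card = m),
      (qBinomProd q R U * qBinomProd q Tt (S - U) *
        q ^ (invPairs R U + invPairs (S - U) Tt)) • XPhi T lam mu (dA U) := by
    rw [xElt_eq_fiberSum, hZ, hT.sum_mul_fiberSum (m := m) (S := S) hcl.monotone_rowOf
      hc4.monotone_rowOf hcmu.monotone_rowOf hν3 hρν hκν hX]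
    · refine Finset.sum_congr rfl fun U hU => ?_
      rw [XPhi]
      congr 1
      refine Finset.sum_congr ?_ fun _ _ => rfl
      ext w
      have hU' := hU
      simp only [Finset.mem_filter, Multiset.mem_toFinset, Multiset.mem_powerset] at hU'
      have hcU := Multiset.card_sub hU'.1
      rw [Finset.mem_filter, Finset.mem_filter, (hdA U hU).mem_doubleCoset_iff hcmu (hsmu _ _
        (by rw [Multiset.card_add]; omega) (by rw [Multiset.card_add]; omega))]
      refine and_congr_right fun _ => ⟨fun ⟨hw0, hw1⟩ i => ?_, fun hw => ⟨hw 0, hw 1⟩⟩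
      rcases (by omega : i = 0 ∨ i = 1 ∨ 1 < i) with rfl | rfl | hi
      · exact hw0
      · exact hw1
      · have h0 := card_rowContent ρ c w i
        rw [hcmu.card_filter_rowOf, hmu,
          show comp2 m (n - m) i = 0 by simp only [comp2]; split_ifs <;> omega,
          Multiset.card_eq_zero] at h0
        rw [h0]
        simp only [rows2]
        split_ifs <;> first | rfl | omega
    all_goals simp only [hc4.card_filter_rowOf]
    all_goals simp [comp4]
    all_goals omega
  intro z
  obtain ⟨a, ha⟩ : ∃ a : Hᵐᵒᵖ, a • (⟨xElt T mu, hxmu⟩ : Mmu) = z := by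
    obtain ⟨a, ha⟩ := Submodule.mem_span_singleton.1 ((SetLike.ext_iff.1 hMmu (z : H)).1 z.2)
    exact ⟨a, Subtype.ext ha⟩
  subst ha
  have e1 : (⟨φB (a • ⟨xElt T mu, hxmu⟩), hrB _⟩ : M4)
      = a • h • ⟨xElt T (comp4 r u v t), hx4⟩ := by
    refine Subtype.ext ?_
    change φB (a • ⟨xElt T mu, hxmu⟩) = a • h • xElt T (comp4 r u v t)
    rw [map_smul, hBx, hh]
  have e2 : (⟨φD ⟨φB (a • ⟨xElt T mu, hxmu⟩), hrB _⟩, hrD _⟩ : M3)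
      = a • h • ⟨xElt T (comp3 r s t), hx3⟩ := by
    refine Subtype.ext ((congrArg φD e1).trans ?_)
    rw [map_smul, map_smul, hDx]
    rfl
  rw [e2, map_smul, map_smul, hEx]
  have e3 : h • (Z * xElt T (comp4 r u v t)) = Z * xElt T mu := by
    rw [← hh, MulOpposite.smul_eq_mul_unop, MulOpposite.smul_eq_mul_unop, mul_assoc]
  rw [e3, hmain, Finset.smul_sum]
  refine Finset.sum_congr rfl fun U hU => ?_
  rw [map_smul, hφA U hU, smul_comm]

end FayersSemistd
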